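/- arXiv:1607.06650 — 2 statements merged into one kernel-verified Lean document; each statement's English description precedes it below -/
import Mathlib

section
/- Let l ≥ 1 be real and let η ∈ C^∞(ℝ) satisfy η(E) = 0 for E ≤ E₁ and η(E) = 1 for E ≥ E₂, where V(0) < E₁ < E₂. Then the function E ↦ η(E) T(E), where T(E) := 4∫₀^{q_M(E)} dq/√(E−V(q)) is the period of the energy-E orbit, is C^∞ on ℝ and of class S̃^{1−l}: for every integer k ≥ 0 there is C_k with |∂_E^k (η(E)T(E))| ≤ C_k ⟨E⟩^{(1−l)/(2l) − k} for all E. -/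
open Real MeasureTheory intervalIntegral

noncomputable section

/-- Japanese bracket `⟨x⟩ = √(1+x²)`. -/
def jap (x : ℝ) : ℝ := Real.sqrt (1 + x ^ 2)

/-- The weight `λ(x,ξ) = (1+ξ²+|x|^{2l})^{1/(2l)}`. -/
def lam (l x ξ : ℝ) : ℝ := (1 + ξ ^ 2 + |x| ^ (2 * l)) ^ (1 / (2 * l))

/-- The symbol class `S^{m₁,m₂}`:  `g ∈ C^∞(ℝ²)` with
`|∂_ξ^{k₁}∂_x^{k₂} g(x,ξ)| ≤ C λ(x,ξ)^{m₁-k₁ l} ⟨x⟩^{m₂-k₂}`. -/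
def IsSymbol (l m₁ m₂ : ℝ) (g : ℝ → ℝ → ℝ) : Prop :=
  ContDiff ℝ (⊤ : ℕ∞) (fun q : ℝ × ℝ => g q.1 q.2) ∧
  ∀ k₁ k₂ : ℕ, ∃ C : ℝ, ∀ x ξ : ℝ,
    |iteratedDeriv k₁ (fun ξ' => iteratedDeriv k₂ (fun x' => g x' ξ') x) ξ|
      ≤ C * lam l x ξ ^ (m₁ - (k₁ : ℝ) * l) * jap x ^ (m₂ - (k₂ : ℝ))

/-- The standing assumptions on the potential `V`: it is `C^∞`, even, has no critical
points away from `0`, satisfies the symbol bounds `|∂_x^k V| ≤ C_k ⟨x⟩^{2l-k}`, and admits an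
asymptotic expansion `V(x) ∼ |x|^{2l} + Σ_{j≥1} V_{2l-2j}(x)` with `V_{2l-2j}` smooth away
from zero and positively homogeneous of degree `2l-2j`. -/
structure GoodPotential (l : ℝ) (V : ℝ → ℝ) : Prop where
  smooth : ContDiff ℝ (⊤ : ℕ∞) V
  even : ∀ x : ℝ, V (-x) = V x
  deriv_ne : ∀ x : ℝ, x ≠ 0 → deriv V x ≠ 0
  growth : ∀ k : ℕ, ∃ C : ℝ, ∀ x : ℝ, |iteratedDeriv k V x| ≤ C * jap x ^ (2 * l - (k : ℝ))
  expansion : ∃ Vh : ℕ → ℝ → ℝ,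
    (∀ j : ℕ, 1 ≤ j →
      ContDiffOn ℝ (⊤ : ℕ∞) (Vh j) {x : ℝ | x ≠ 0} ∧
      ∀ ρ : ℝ, 0 < ρ → ∀ x : ℝ, Vh j (ρ * x) = ρ ^ (2 * l - 2 * (j : ℝ)) * Vh j x) ∧
    ∀ N k : ℕ, ∃ C R : ℝ, ∀ x : ℝ, R ≤ |x| →
      |iteratedDeriv k (fun y => V y - |y| ^ (2 * l) - ∑ j ∈ Finset.Icc 1 N, Vh j y) x|
        ≤ C * |x| ^ (2 * l - 2 * ((N : ℝ) + 1) - (k : ℝ))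

/-- `qM` is the turning point function: the unique positive solution of `V(q_M(E)) = E`
for `E > V 0`. -/
def IsTurningPoint (V qM : ℝ → ℝ) : Prop :=
  ∀ E : ℝ, V 0 < E →
    0 < qM E ∧ V (qM E) = E ∧ ∀ q : ℝ, 0 < q → V q = E → q = qM E

/-- The period `T(E) = 4∫₀^{q_M(E)} dq/√(E-V(q))`. -/
def period (V qM : ℝ → ℝ) (E : ℝ) : ℝ :=
  4 * ∫ q in (0:ℝ)..(qM E), (Real.sqrt (E - V q))⁻¹

/-- The orbit average
`⟨p⟩(E) = (1/T(E)) ∫_{-q_M}^{q_M} [p(q,√(E-V q)) + p(q,-√(E-V q))]/√(E-V q) dq`. -/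
def orbitAvg (V qM : ℝ → ℝ) (p : ℝ → ℝ → ℝ) (E : ℝ) : ℝ :=
  (period V qM E)⁻¹ *
    ∫ q in (-(qM E))..(qM E),
      (p q (Real.sqrt (E - V q)) + p q (-Real.sqrt (E - V q))) / Real.sqrt (E - V q)

/-- Finite-order symbol estimates on the half-line `(b, ∞)`: `f` is `n` times differentiable there
and its `k`-th derivative is `O(t ^ (m - k))` for `k ≤ n`. -/
def SymOn (b : ℝ) : ℕ → ℝ → (ℝ → ℝ) → Prop
  | 0, m, f => ∃ C : ℝ, ∀ t, b < t → |f t| ≤ C * t ^ m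
  | n + 1, m, f => (∃ C : ℝ, ∀ t, b < t → |f t| ≤ C * t ^ m) ∧
      ∃ f' : ℝ → ℝ, (∀ t, b < t → HasDerivAt f (f' t) t) ∧ SymOn b n (m - 1) f'

namespace SymOn

variable {b m m' : ℝ} {n : ℕ} {f g : ℝ → ℝ}

lemma bound (h : SymOn b n m f) : ∃ C : ℝ, ∀ t, b < t → |f t| ≤ C * t ^ m := by
  cases n with
  | zero => exact h
  | succ n => exact h.1

lemma bound_nonneg (hb : 0 < b) (h : SymOn b n m f) :
    ∃ C : ℝ, 0 ≤ C ∧ ∀ t, b < t → |f t| ≤ C * t ^ m := by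
  obtain ⟨C, hC⟩ := h.bound
  refine ⟨|C|, abs_nonneg C, fun t ht => (hC t ht).trans ?_⟩
  have : 0 < t ^ m := rpow_pos_of_pos (hb.trans ht) m
  gcongr
  exact le_abs_self C

lemma of_succ (h : SymOn b (n + 1) m f) : SymOn b n m f := by
  induction n generalizing m f with
  | zero => exact h.1
  | succ n ih =>
    obtain ⟨h0, f', hf', h1⟩ := h
    exact ⟨h0, f', hf', ih h1⟩

lemma continuousOn (h : SymOn b (n + 1) m f) : ContinuousOn f (Set.Ioi b) := by
  obtain ⟨-, f', hf', -⟩ := h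
  exact fun t ht => (hf' t ht).continuousAt.continuousWithinAt

lemma congr (h : SymOn b n m f) (hfg : ∀ t, b < t → g t = f t) : SymOn b n m g := by
  have h0 : ∃ C : ℝ, ∀ t, b < t → |g t| ≤ C * t ^ m := by
    obtain ⟨C, hC⟩ := h.bound
    exact ⟨C, fun t ht => by rw [hfg t ht]; exact hC t ht⟩
  cases n with
  | zero => exact h0
  | succ n =>
    obtain ⟨-, f', hf', h1⟩ := h
    refine ⟨h0, f', fun t ht => (hf' t ht).congr_of_eventuallyEq ?_, h1⟩
    filter_upwards [lt_mem_nhds ht] with s hs using hfg s hs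

lemma mono_order (hb : 0 < b) (h : SymOn b n m f) (hm : m ≤ m') : SymOn b n m' f := by
  have h0 : ∀ {m m' : ℝ} {f : ℝ → ℝ} {n : ℕ}, SymOn b n m f → m ≤ m' →
      ∃ C : ℝ, ∀ t, b < t → |f t| ≤ C * t ^ m' := by
    intro m m' f n h hm
    obtain ⟨C, hC0, hC⟩ := h.bound_nonneg hb
    refine ⟨C * b ^ (m - m'), fun t ht => (hC t ht).trans ?_⟩
    have ht0 : 0 < t := hb.trans ht
    have : t ^ m = t ^ (m - m') * t ^ m' := by rw [← rpow_add ht0]; ring_nf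
    rw [this, mul_assoc]
    have h2 : t ^ (m - m') ≤ b ^ (m - m') :=
      rpow_le_rpow_of_nonpos hb ht.le (by linarith)
    gcongr
  induction n generalizing m m' f with
  | zero => exact h0 h hm
  | succ n ih =>
    obtain ⟨-, f', hf', h1⟩ := id h
    exact ⟨h0 h hm, f', hf', ih h1 (by linarith)⟩

lemma add (h : SymOn b n m f) (h' : SymOn b n m g) : SymOn b n m (fun t => f t + g t) := by
  have h0 : ∃ C : ℝ, ∀ t, b < t → |f t + g t| ≤ C * t ^ m := by
    obtain ⟨C, hC⟩ := h.bound
    obtain ⟨D, hD⟩ := h'.bound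
    refine ⟨C + D, fun t ht => (abs_add_le _ _).trans ?_⟩
    rw [add_mul]
    exact add_le_add (hC t ht) (hD t ht)
  induction n generalizing m f g with
  | zero => exact h0
  | succ n ih =>
    obtain ⟨-, f', hf', h1⟩ := h
    obtain ⟨-, g', hg', h2⟩ := h'
    refine ⟨h0, _, fun t ht => (hf' t ht).add (hg' t ht), ih h1 h2 ?_⟩
    obtain ⟨C, hC⟩ := h1.bound
    obtain ⟨D, hD⟩ := h2.bound
    refine ⟨C + D, fun t ht => (abs_add_le _ _).trans ?_⟩
    rw [add_mul]
    exact add_le_add (hC t ht) (hD t ht)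

lemma mul (hb : 0 < b) (h : SymOn b n m f) (h' : SymOn b n m' g) :
    SymOn b n (m + m') (fun t => f t * g t) := by
  have h0 : ∀ {m m' : ℝ} {f g : ℝ → ℝ} {n : ℕ}, SymOn b n m f → SymOn b n m' g →
      ∃ C : ℝ, ∀ t, b < t → |f t * g t| ≤ C * t ^ (m + m') := by
    intro m m' f g n h h'
    obtain ⟨C, hC0, hC⟩ := h.bound_nonneg hb
    obtain ⟨D, hD⟩ := h'.bound
    refine ⟨C * D, fun t ht => ?_⟩
    have ht0 : 0 < t := hb.trans ht
    rw [abs_mul, rpow_add ht0, mul_mul_mul_comm]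
    have : 0 < t ^ m := rpow_pos_of_pos ht0 m
    exact mul_le_mul (hC t ht) (hD t ht) (abs_nonneg _) (by positivity)
  induction n generalizing m m' f g with
  | zero => exact h0 h h'
  | succ n ih =>
    obtain ⟨-, f', hf', h1⟩ := id h
    obtain ⟨-, g', hg', h2⟩ := id h'
    refine ⟨h0 h h', _, fun t ht => (hf' t ht).mul (hg' t ht), ?_⟩
    have e1 := ih h1 h'.of_succ
    have e2 := ih h.of_succ h2
    rw [show m - 1 + m' = m + m' - 1 by ring] at e1
    rw [show m + (m' - 1) = m + m' - 1 by ring] at e2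
    exact e1.add e2

lemma const (c : ℝ) : SymOn b n 0 (fun _ => c) := by
  have h0 : ∀ (n : ℕ) (m : ℝ), SymOn b n m (fun _ => 0) := by
    intro n
    induction n with
    | zero => exact fun m => ⟨0, fun t _ => by simp⟩
    | succ n ih =>
      exact fun m => ⟨⟨0, fun t _ => by simp⟩, _, fun t _ => hasDerivAt_const t 0, ih _⟩
  cases n with
  | zero => exact ⟨|c|, fun t _ => by simp⟩
  | succ n => exact ⟨⟨|c|, fun t _ => by simp⟩, _, fun t _ => hasDerivAt_const t c, h0 n _⟩

lemma inv (hb : 0 < b) (h : SymOn b n m f) {c : ℝ} (hc : 0 < c)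
    (hf : ∀ t, b < t → c * t ^ m ≤ f t) : SymOn b n (-m) (fun t => (f t)⁻¹) := by
  have hpos : ∀ t, b < t → 0 < f t := fun t ht =>
    (mul_pos hc (rpow_pos_of_pos (hb.trans ht) m)).trans_le (hf t ht)
  have h0 : ∃ C : ℝ, ∀ t, b < t → |(f t)⁻¹| ≤ C * t ^ (-m) := by
    refine ⟨c⁻¹, fun t ht => ?_⟩
    have ht0 : 0 < t := hb.trans ht
    have : 0 < t ^ m := rpow_pos_of_pos ht0 m
    rw [abs_of_pos (inv_pos.2 (hpos t ht)), rpow_neg ht0.le, ← mul_inv]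
    exact inv_anti₀ (by positivity) (hf t ht)
  induction n with
  | zero => exact h0
  | succ n ih =>
    obtain ⟨-, f', hf', h1⟩ := id h
    have ihn := ih h.of_succ
    refine ⟨h0, _, fun t ht => (hf' t ht).inv (hpos t ht).ne', ?_⟩
    have e := ((const (b := b) (n := n) (-1)).mul hb h1).mul hb (ihn.mul hb ihn)
    rw [show 0 + (m - 1) + (-m + -m) = -m - 1 by ring] at e
    refine e.congr fun t ht => ?_
    have := (hpos t ht).ne'
    field_simp

lemma hasDerivAt_iteratedDeriv (h : ∀ n, SymOn b n m f) (k : ℕ) :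
    (∀ t, b < t → HasDerivAt (iteratedDeriv k f) (iteratedDeriv (k + 1) f t) t) ∧
      ∀ n, SymOn b n (m - k) (iteratedDeriv k f) := by
  have step : ∀ (m : ℝ) (g : ℝ → ℝ), (∀ n, SymOn b n m g) →
      (∀ t, b < t → HasDerivAt g (deriv g t) t) ∧ ∀ n, SymOn b n (m - 1) (deriv g) := by
    intro m g hg
    refine ⟨fun t ht => ?_, fun n => ?_⟩
    · obtain ⟨-, g', hg', -⟩ := hg 1
      exact (hg' t ht).differentiableAt.hasDerivAt
    · obtain ⟨-, g', hg', h1⟩ := hg (n + 1)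
      exact h1.congr fun t ht => (hg' t ht).deriv
  have key : ∀ n, SymOn b n (m - k) (iteratedDeriv k f) := by
    induction k with
    | zero => simpa using h
    | succ k ih =>
      intro n
      have := (step _ _ ih).2 n
      rw [iteratedDeriv_succ]
      push_cast
      rwa [← sub_sub]
  refine ⟨fun t ht => ?_, key⟩
  rw [iteratedDeriv_succ]
  exact (step _ _ key).1 t ht

lemma contDiffOn (h : ∀ n, SymOn b n m f) : ContDiffOn ℝ (⊤ : ℕ∞) f (Set.Ioi b) := by
  refine contDiffOn_infty.2 fun n => ?_
  have : ∀ (n : ℕ) (m : ℝ) (g : ℝ → ℝ), SymOn b (n + 1) m g → ContDiffOn ℝ n g (Set.Ioi b) := by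
    intro n
    induction n with
    | zero => exact fun m g hg => contDiffOn_zero.2 hg.continuousOn
    | succ n ih =>
      intro m g ⟨_, g', hg', h1⟩
      rw [Nat.cast_add, Nat.cast_one, contDiffOn_succ_iff_deriv_of_isOpen isOpen_Ioi]
      refine ⟨fun t ht => (hg' t ht).differentiableAt.differentiableWithinAt, by simp, ?_⟩
      exact (ih _ _ h1).congr fun t ht => (hg' t ht).deriv
  exact this n m f (h _)

lemma of_iteratedDeriv (hf : ContDiff ℝ (⊤ : ℕ∞) f)
    (h : ∀ k : ℕ, ∃ C : ℝ, ∀ t, b < t → |iteratedDeriv k f t| ≤ C * t ^ (m - k)) (n k : ℕ) :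
    SymOn b n (m - k) (iteratedDeriv k f) := by
  induction n generalizing k with
  | zero => exact h k
  | succ n ih =>
    refine ⟨h k, iteratedDeriv (k + 1) f, fun t _ => ?_, ?_⟩
    · rw [iteratedDeriv_succ]
      exact ((hf.differentiable_iteratedDeriv k (by exact_mod_cast WithTop.coe_lt_top k)) t).hasDerivAt
    · have := ih (k + 1)
      push_cast at this
      rwa [← sub_sub] at this

/-- Composition of a symbol with the solution `X` of `X' = 1 / (p ∘ X)`. -/
lemma comp_of_hasDerivAt_inv {a r : ℝ} {X p : ℝ → ℝ} (ha : 0 < a) (hb : 0 < b)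
    {c₁ c₂ c₃ : ℝ} (hc₁ : 0 < c₁) (hc₃ : 0 < c₃)
    (hXa : ∀ v, b < v → a < X v)
    (hX₁ : ∀ v, b < v → c₁ * v ^ (1 / r) ≤ X v) (hX₂ : ∀ v, b < v → X v ≤ c₂ * v ^ (1 / r))
    (hr : 0 < r) (hp : ∀ n, SymOn a n (r - 1) p)
    (hp₁ : ∀ v, b < v → c₃ * v ^ ((r - 1) / r) ≤ p (X v))
    (hX : ∀ v, b < v → HasDerivAt X (p (X v))⁻¹ v)
    {h : ℝ → ℝ} (hh : ∀ n, SymOn a n m h) (n : ℕ) :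
    SymOn b n (m / r) (fun v => h (X v)) := by
  have h0 : ∀ {m : ℝ} {h : ℝ → ℝ}, (∀ n, SymOn a n m h) →
      ∃ C : ℝ, ∀ v, b < v → |h (X v)| ≤ C * v ^ (m / r) := by
    intro m h hh
    obtain ⟨C, hC0, hC⟩ := (hh 0).bound_nonneg ha
    refine ⟨C * (c₁ ^ m + c₂ ^ m), fun v hv => (hC _ (hXa v hv)).trans ?_⟩
    have hv0 : 0 < v := hb.trans hv
    have hv1 : 0 < v ^ (1 / r) := rpow_pos_of_pos hv0 _
    have hX0 : 0 < X v := ha.trans (hXa v hv)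
    have hc₂ : 0 < c₂ := by
      by_contra hcon
      have := hX₂ v hv
      nlinarith
    have e : v ^ (m / r) = (v ^ (1 / r)) ^ m := by rw [← rpow_mul hv0.le]; ring_nf
    have p1 := rpow_pos_of_pos hc₁ m
    have p2 := rpow_pos_of_pos hc₂ m
    have p3 := rpow_pos_of_pos hv1 m
    rw [mul_assoc, e]
    gcongr
    rw [add_mul, ← mul_rpow hc₁.le hv1.le, ← mul_rpow hc₂.le hv1.le]
    rcases le_total 0 m with hm | hm
    · have := rpow_le_rpow hX0.le (hX₂ v hv) hm
      have : 0 ≤ (c₁ * v ^ (1 / r)) ^ m := by positivity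
      linarith
    · have := rpow_le_rpow_of_nonpos (by positivity) (hX₁ v hv) hm
      have : 0 ≤ (c₂ * v ^ (1 / r)) ^ m := by positivity
      linarith
  induction n generalizing m h with
  | zero => exact h0 hh
  | succ n ih =>
    have hd := hasDerivAt_iteratedDeriv hh 0
    have hd1 := (hasDerivAt_iteratedDeriv hh 1).2
    rw [iteratedDeriv_zero, zero_add] at hd
    refine ⟨h0 hh, fun v => iteratedDeriv 1 h (X v) * (p (X v))⁻¹, fun v hv => ?_, ?_⟩
    · exact (hd.1 _ (hXa v hv)).comp v (hX v hv)
    · have e := (ih hd1).mul hb ((ih hp).inv hb hc₃ hp₁)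
      rwa [show (m - (1 : ℕ)) / r + -((r - 1) / r) = m / r - 1 by
        push_cast; field_simp; ring] at e

lemma sub_rpow {d : ℝ} (hd : 0 ≤ d) (hdb : d < b) (p : ℝ) (n : ℕ) :
    SymOn b n p (fun t => (t - d) ^ p) := by
  have hb : 0 < b := hd.trans_lt hdb
  have h0 : ∀ p : ℝ, ∃ C : ℝ, ∀ t, b < t → |(t - d) ^ p| ≤ C * t ^ p := by
    intro p
    refine ⟨1 + (1 - d / b) ^ p, fun t ht => ?_⟩
    have ht0 : 0 < t := hb.trans ht
    have k0 : 0 < 1 - d / b := by rw [sub_pos, div_lt_one hb]; exact hdb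
    have k1 : (1 - d / b) * t ≤ t - d := by
      have : d ≤ d / b * t := by
        rw [div_mul_eq_mul_div, le_div_iff₀ hb]
        exact mul_le_mul_of_nonneg_left ht.le hd
      linarith
    have p1 := rpow_pos_of_pos k0 p
    have p2 := rpow_pos_of_pos ht0 p
    rw [abs_of_nonneg (rpow_nonneg (by linarith) p), add_mul, ← mul_rpow k0.le ht0.le, one_mul]
    rcases le_total 0 p with hp | hp
    · have := rpow_le_rpow (by linarith) (show t - d ≤ t by linarith) hp
      have : 0 ≤ ((1 - d / b) * t) ^ p := by positivity
      linarith
    · have := rpow_le_rpow_of_nonpos (by positivity) k1 hp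
      linarith
  induction n generalizing p with
  | zero => exact h0 p
  | succ n ih =>
    refine ⟨h0 p, fun t => p * (t - d) ^ (p - 1), fun t ht => ?_, ?_⟩
    · have := ((hasDerivAt_id t).sub_const d).rpow_const (p := p)
        (Or.inl (by simp only [id]; linarith))
      simpa using this
    · simpa using (const p).mul hb (ih (p - 1))

end SymOn

/-- Symbol estimates for an integral depending on a parameter. -/
lemma symOn_integral {α : Type*} [MeasurableSpace α] (μ : Measure α) {c m : ℝ} (hc : 0 < c)
    (hm : m ≤ 0) (Φ : ℕ → ℝ → α → ℝ) {g : α → ℝ} (hg : Integrable g μ) (hg0 : ∀ᵐ s ∂μ, 0 ≤ g s)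
    (hmeas : ∀ k t, c < t → AEStronglyMeasurable (Φ k t) μ)
    (hder : ∀ k, ∀ᵐ s ∂μ, ∀ t, c < t → HasDerivAt (fun t => Φ k t s) (Φ (k + 1) t s) t)
    (hbd : ∀ k : ℕ, ∃ C : ℝ, 0 ≤ C ∧ ∀ᵐ s ∂μ, ∀ t, c < t → |Φ k t s| ≤ C * t ^ (m - k) * g s)
    (n k : ℕ) : SymOn c n (m - k) (fun t => ∫ s, Φ k t s ∂μ) := by
  have h0 : ∀ k : ℕ, ∃ C : ℝ, ∀ t, c < t → |∫ s, Φ k t s ∂μ| ≤ C * t ^ (m - k) := by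
    intro k
    obtain ⟨C, -, hC⟩ := hbd k
    refine ⟨C * ∫ s, g s ∂μ, fun t ht => ?_⟩
    have := norm_integral_le_of_norm_le (f := Φ k t) (hg.const_mul (C * t ^ (m - k)))
      (by filter_upwards [hC] with s hs using hs t ht)
    rw [MeasureTheory.integral_const_mul] at this
    calc _ ≤ _ := this
      _ = _ := by ring
  induction n generalizing k with
  | zero => exact h0 k
  | succ n ih =>
    refine ⟨h0 k, fun t => ∫ s, Φ (k + 1) t s ∂μ, fun t ht => ?_, ?_⟩
    · obtain ⟨C, hC0, hC⟩ := hbd (k + 1)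
      obtain ⟨D, -, hD⟩ := hbd k
      refine (hasDerivAt_integral_of_dominated_loc_of_deriv_le (s := Set.Ioi c)
        (F := fun t s => Φ k t s) (F' := fun t s => Φ (k + 1) t s)
        (bound := fun s => C * c ^ (m - (k + 1 : ℕ)) * g s)
        (lt_mem_nhds ht) ?_ ?_ (hmeas _ t ht) ?_ (hg.const_mul _) ?_).2
      · filter_upwards [lt_mem_nhds ht] with u hu using hmeas k u hu
      · refine Integrable.mono' (hg.const_mul (D * t ^ (m - k))) (hmeas k t ht) ?_
        filter_upwards [hD] with s hs using hs t ht
      · filter_upwards [hC, hg0] with s hs hgs u hu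
        refine (hs u hu).trans ?_
        have : u ^ (m - (k + 1 : ℕ)) ≤ c ^ (m - (k + 1 : ℕ)) :=
          rpow_le_rpow_of_nonpos hc (le_of_lt hu) (by push_cast; linarith [k.cast_nonneg (α := ℝ)])
        gcongr
      · filter_upwards [hder k] with s hs u hu using hs u hu
    · have := ih (k + 1)
      push_cast at this
      rwa [← sub_sub] at this

lemma jap_pos (x : ℝ) : 0 < jap x := Real.sqrt_pos.2 (by positivity)

lemma le_jap (x : ℝ) : x ≤ jap x := Real.le_sqrt_of_sq_le (by linarith)

lemma jap_le_one_add {x : ℝ} (hx : 0 ≤ x) : jap x ≤ 1 + x :=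
  Real.sqrt_le_iff.2 ⟨by positivity, by nlinarith⟩

lemma continuous_jap : Continuous jap := by unfold jap; fun_prop

lemma jap_rpow_le {a : ℝ} (ha : 0 < a) (p : ℝ) :
    ∃ C : ℝ, 0 ≤ C ∧ ∀ t, a < t → jap t ^ p ≤ C * t ^ p := by
  refine ⟨1 + (1 / a + 1) ^ p, by positivity, fun t ht => ?_⟩
  have ht0 : 0 < t := ha.trans ht
  have h1 : jap t ≤ (1 / a + 1) * t := by
    have : 1 ≤ 1 / a * t := by rw [div_mul_eq_mul_div, le_div_iff₀ ha]; linarith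
    linarith [jap_le_one_add ht0.le]
  have p1 : 0 ≤ ((1 / a + 1) * t) ^ p := by positivity
  have p2 : 0 < t ^ p := rpow_pos_of_pos ht0 p
  rw [add_mul, one_mul, ← mul_rpow (by positivity) ht0.le]
  rcases le_total 0 p with hp | hp
  · linarith [rpow_le_rpow (jap_pos t).le h1 hp]
  · linarith [rpow_le_rpow_of_nonpos ht0 (le_jap t) hp]

/-- A positive continuous function on `[a, ∞)` asymptotic to `A * q ^ p` is bounded below by a
positive multiple of `q ^ p`. -/
lemma exists_mul_rpow_le {a A p C R : ℝ} {φ : ℝ → ℝ} (ha : 0 < a) (hA : 0 < A)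
    (hφ : ContinuousOn φ (Set.Ici a)) (hpos : ∀ q, a ≤ q → 0 < φ q)
    (h : ∀ q, R ≤ q → |φ q - A * q ^ p| ≤ C * q ^ (p - 2)) :
    ∃ c : ℝ, 0 < c ∧ ∀ q, a ≤ q → c * q ^ p ≤ φ q := by
  set R' := max a (max R (√(2 * |C| / A)))
  have haR : a ≤ R' := le_max_left _ _
  have hcont : ContinuousOn (fun q => φ q / q ^ p) (Set.Icc a R') := by
    refine (hφ.mono Set.Icc_subset_Ici_self).div ?_ ?_
    · exact fun q hq => (continuousAt_rpow_const q p
        (Or.inl (ha.trans_le hq.1).ne')).continuousWithinAt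
    · exact fun q hq => (rpow_pos_of_pos (ha.trans_le hq.1) p).ne'
  obtain ⟨q₀, hq₀, hmin⟩ := isCompact_Icc.exists_isMinOn ⟨a, le_refl a, haR⟩ hcont
  have hc0 : 0 < φ q₀ / q₀ ^ p := div_pos (hpos _ hq₀.1) (rpow_pos_of_pos (ha.trans_le hq₀.1) p)
  refine ⟨min (φ q₀ / q₀ ^ p) (A / 2), lt_min hc0 (by positivity), fun q hq => ?_⟩
  have hq0 : 0 < q := ha.trans_le hq
  have hqp := rpow_pos_of_pos hq0 p
  rcases le_total q R' with hqR | hqR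
  · have h1 : φ q₀ / q₀ ^ p ≤ φ q / q ^ p := hmin (Set.mem_Icc.2 ⟨hq, hqR⟩)
    rw [le_div_iff₀ hqp] at h1
    exact (mul_le_mul_of_nonneg_right (min_le_left _ _) hqp.le).trans h1
  · have hRq : R ≤ q := ((le_max_left _ _).trans (le_max_right _ _)).trans hqR
    have hsq : √(2 * |C| / A) ≤ q := ((le_max_right _ _).trans (le_max_right _ _)).trans hqR
    rw [Real.sqrt_le_left hq0.le, div_le_iff₀ hA] at hsq
    have e : q ^ p = q ^ (p - 2) * q ^ 2 := by
      rw [← rpow_natCast, ← rpow_add hq0]; norm_num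
    have h2 : C * q ^ (p - 2) ≤ A / 2 * q ^ p := by
      have := rpow_pos_of_pos hq0 (p - 2)
      rw [e, mul_comm (q ^ (p - 2)), ← mul_assoc]
      gcongr
      linarith [le_abs_self C]
    have h3 := (abs_le.1 (h q hRq)).1
    have h4 := mul_le_mul_of_nonneg_right (min_le_right (φ q₀ / q₀ ^ p) (A / 2)) hqp.le
    linarith

namespace GoodPotential

variable {l : ℝ} {V : ℝ → ℝ}

lemma hasDerivAt (hV : GoodPotential l V) (q : ℝ) : HasDerivAt V (deriv V q) q :=
  (hV.smooth.differentiable (by simp) q).hasDerivAt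

lemma symOn (hV : GoodPotential l V) {a : ℝ} (ha : 0 < a) (n : ℕ) : SymOn a n (2 * l) V := by
  have := SymOn.of_iteratedDeriv (b := a) (m := 2 * l) hV.smooth (fun k => by
    obtain ⟨C, hC⟩ := hV.growth k
    obtain ⟨D, hD0, hD⟩ := jap_rpow_le ha (2 * l - k)
    refine ⟨|C| * D, fun t ht => (hC t).trans ?_⟩
    have := hD t ht
    have := rpow_pos_of_pos (jap_pos t) (2 * l - k)
    rw [mul_assoc]
    gcongr
    exact le_abs_self C) n 0
  simpa using this

lemma symOn_deriv (hV : GoodPotential l V) {a : ℝ} (ha : 0 < a) (n : ℕ) :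
    SymOn a n (2 * l - 1) (deriv V) := by
  have := (SymOn.hasDerivAt_iteratedDeriv (hV.symOn ha) 1).2 n
  simpa [iteratedDeriv_one] using this

lemma deriv_pos (hV : GoodPotential l V) {qM : ℝ → ℝ} (hqM : IsTurningPoint V qM) {q : ℝ}
    (hq : 0 < q) : 0 < deriv V q := by
  have h := hasDerivWithinAt_forall_lt_or_forall_gt_of_forall_ne (convex_Ioi (0 : ℝ))
    (f := V) (f' := deriv V) (m := 0) (fun x _ => (hV.hasDerivAt x).hasDerivWithinAt)
    (fun x hx => hV.deriv_ne x (ne_of_gt hx))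
  rcases h with h | h
  · exfalso
    have hanti : StrictAntiOn V (Set.Ici 0) :=
      strictAntiOn_of_deriv_neg (convex_Ici 0) hV.smooth.continuous.continuousOn
        (fun x hx => h x (by simpa using hx))
    obtain ⟨h1, h2, -⟩ := hqM (V 0 + 1) (by linarith)
    have := hanti (Set.mem_Ici.2 le_rfl) (Set.mem_Ici.2 h1.le) h1
    linarith
  · exact h q hq

lemma strictMonoOn (hV : GoodPotential l V) {qM : ℝ → ℝ} (hqM : IsTurningPoint V qM) :
    StrictMonoOn V (Set.Ici 0) :=
  strictMonoOn_of_deriv_pos (convex_Ici 0) hV.smooth.continuous.continuousOn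
    (fun x hx => hV.deriv_pos hqM (by simpa using hx))

lemma exists_le_sub (hV : GoodPotential l V) (hl : 1 ≤ l) {qM : ℝ → ℝ}
    (hqM : IsTurningPoint V qM) {a : ℝ} (ha : 0 < a) :
    ∃ c : ℝ, 0 < c ∧ ∀ q, a ≤ q → c * q ^ (2 * l) ≤ V q - V 0 := by
  obtain ⟨Vh, -, h⟩ := hV.expansion
  obtain ⟨C, R, hCR⟩ := h 0 0
  refine exists_mul_rpow_le (A := 1) (C := C + |V 0|) (R := max R 1) ha one_pos
    (by have := hV.smooth.continuous; fun_prop) (fun q hq => ?_) (fun q hq => ?_)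
  · have := hV.strictMonoOn hqM (Set.mem_Ici.2 le_rfl) (Set.mem_Ici.2 (ha.trans_le hq).le)
      (ha.trans_le hq)
    linarith
  · have hq1 : 1 ≤ q := (le_max_right _ _).trans hq
    have hq0 : 0 < q := by linarith
    have h1 := hCR q (by rw [abs_of_pos hq0]; exact (le_max_left _ _).trans hq)
    simp only [iteratedDeriv_zero, abs_of_pos hq0] at h1
    norm_num at h1
    have h2 : 1 ≤ q ^ (2 * l - 2) := one_le_rpow hq1 (by linarith)
    have h3 : |V 0| ≤ |V 0| * q ^ (2 * l - 2) := le_mul_of_one_le_right (abs_nonneg _) h2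
    calc |V q - V 0 - 1 * q ^ (2 * l)| = |(V q - q ^ (2 * l)) - V 0| := by ring_nf
      _ ≤ |V q - q ^ (2 * l)| + |V 0| := abs_sub _ _
      _ ≤ _ := by rw [add_mul]; linarith

lemma exists_le_deriv (hV : GoodPotential l V) (hl : 1 ≤ l) {qM : ℝ → ℝ}
    (hqM : IsTurningPoint V qM) {a : ℝ} (ha : 0 < a) :
    ∃ c : ℝ, 0 < c ∧ ∀ q, a ≤ q → c * q ^ (2 * l - 1) ≤ deriv V q := by
  obtain ⟨Vh, -, h⟩ := hV.expansion
  obtain ⟨C, R, hCR⟩ := h 0 1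
  refine exists_mul_rpow_le (A := 2 * l) (C := C) (R := max R 1) ha (by linarith)
    ((hV.smooth.continuous_deriv (by simp)).continuousOn)
    (fun q hq => hV.deriv_pos hqM (ha.trans_le hq)) (fun q hq => ?_)
  have hq1 : 1 ≤ q := (le_max_right _ _).trans hq
  have hq0 : 0 < q := by linarith
  have h1 := hCR q (by rw [abs_of_pos hq0]; exact (le_max_left _ _).trans hq)
  have hd : HasDerivAt (fun y => V y - |y| ^ (2 * l) - ∑ j ∈ Finset.Icc 1 0, Vh j y)
      (deriv V q - 2 * l * q ^ (2 * l - 1)) q := by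
    refine ((hV.hasDerivAt q).sub
      (Real.hasDerivAt_rpow_const (p := 2 * l) (Or.inl hq0.ne'))).congr_of_eventuallyEq ?_
    filter_upwards [lt_mem_nhds hq0] with y hy
    simp [abs_of_pos hy]
  rw [iteratedDeriv_one, hd.deriv, abs_of_pos hq0] at h1
  convert h1 using 3
  push_cast
  ring

lemma exists_sub_le (hV : GoodPotential l V) (hl : 1 ≤ l) {a : ℝ} (ha : 0 < a) :
    ∃ c : ℝ, 0 < c ∧ ∀ q, a < q → V q - V 0 ≤ c * q ^ (2 * l) := by
  have h := (hV.symOn ha 0).add ((SymOn.const (b := a) (n := 0) (-V 0)).mono_order ha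
    (by linarith : (0 : ℝ) ≤ 2 * l))
  obtain ⟨C, hC0, hC⟩ := h.bound_nonneg ha
  refine ⟨C + 1, by linarith, fun q hq => ?_⟩
  have := (le_abs_self _).trans (hC q hq)
  have := rpow_pos_of_pos (ha.trans hq) (2 * l)
  linarith

end GoodPotential

namespace IsTurningPoint

variable {l : ℝ} {V qM : ℝ → ℝ}

lemma hasDerivAt (hqM : IsTurningPoint V qM) (hV : GoodPotential l V) {v : ℝ} (hv : 0 < v) :
    HasDerivAt (fun v => qM (V 0 + v)) (deriv V (qM (V 0 + v)))⁻¹ v := by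
  obtain ⟨h1, h2, -⟩ := hqM (V 0 + v) (by linarith)
  set q := qM (V 0 + v)
  have hstr : HasStrictDerivAt (fun q => V q - V 0) (deriv V q) q :=
    ((hV.smooth.contDiffAt).hasStrictDerivAt (by simp)).sub_const (V 0)
  have hne := hV.deriv_ne q h1.ne'
  have hinv := hstr.to_localInverse hne
  have hq : V q - V 0 = v := by rw [h2]; ring
  have hr := (hstr.hasStrictFDerivAt_equiv hne).eventually_right_inverse
  have hval : hstr.localInverse _ _ _ hne (V q - V 0) = q :=
    (hstr.hasStrictFDerivAt_equiv hne).localInverse_apply_image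
  have hcont := hinv.hasDerivAt.continuousAt
  have hpos : ∀ᶠ y in nhds (V q - V 0), 0 < hstr.localInverse _ _ _ hne y :=
    hcont.eventually (lt_mem_nhds (by rw [hval]; exact h1))
  rw [hq] at hpos hr
  have hd := hinv.hasDerivAt
  simp only [hq] at hd
  refine hd.congr_of_eventuallyEq ?_
  filter_upwards [hpos, hr, lt_mem_nhds hv] with y hy1 hy2 hy3
  refine ((hqM (V 0 + y) (by linarith)).2.2 _ hy1 ?_).symm
  have : V (hstr.localInverse _ _ _ hne y) - V 0 = y := hy2
  linarith

/-- The derivative of the turning point with respect to the energy is a symbol of order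
`1 / (2 l) - 1`. -/
lemma symOn_inv_deriv (hqM : IsTurningPoint V qM) (hV : GoodPotential l V) (hl : 1 ≤ l)
    {d : ℝ} (hd : 0 < d) (n : ℕ) :
    SymOn d n (1 / (2 * l) - 1) (fun v => (deriv V (qM (V 0 + v)))⁻¹) := by
  obtain ⟨ha, hVa, -⟩ := hqM (V 0 + d) (by linarith)
  set a := qM (V 0 + d)
  obtain ⟨c₁, hc₁, h₁⟩ := hV.exists_le_sub hl hqM ha
  obtain ⟨c₂, hc₂, h₂⟩ := hV.exists_sub_le hl ha
  obtain ⟨c₃, hc₃, h₃⟩ := hV.exists_le_deriv hl hqM ha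
  have hl0 : 0 < 2 * l := by linarith
  have hX : ∀ v, d < v → a < qM (V 0 + v) ∧ V (qM (V 0 + v)) = V 0 + v := by
    intro v hv
    obtain ⟨hp, hVp, -⟩ := hqM (V 0 + v) (by linarith)
    refine ⟨?_, hVp⟩
    rw [← (hV.strictMonoOn hqM).lt_iff_lt (Set.mem_Ici.2 ha.le) (Set.mem_Ici.2 hp.le), hVa, hVp]
    linarith
  have root : ∀ x : ℝ, 0 ≤ x → (x ^ (2 * l)) ^ (1 / (2 * l)) = x := by
    intro x hx
    rw [← rpow_mul hx, mul_one_div_cancel hl0.ne', rpow_one]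
  set k₁ := (1 / c₂) ^ (1 / (2 * l))
  have hk₁ : 0 < k₁ := by positivity
  have hX₁ : ∀ v, d < v → k₁ * v ^ (1 / (2 * l)) ≤ qM (V 0 + v) := by
    intro v hv
    have hx := (hX v hv).1
    have := h₂ _ hx
    rw [(hX v hv).2, add_sub_cancel_left] at this
    rw [← mul_rpow (by positivity) (hd.trans hv).le, ← root (qM (V 0 + v)) (ha.trans hx).le]
    refine rpow_le_rpow (by have := hd.trans hv; positivity) ?_ (by positivity)
    rw [one_div_mul_eq_div, div_le_iff₀ hc₂]
    linarith
  have hX₂ : ∀ v, d < v → qM (V 0 + v) ≤ (1 / c₁) ^ (1 / (2 * l)) * v ^ (1 / (2 * l)) := by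
    intro v hv
    have hx := (hX v hv).1
    have := h₁ _ hx.le
    rw [(hX v hv).2, add_sub_cancel_left] at this
    rw [← mul_rpow (by positivity) (hd.trans hv).le, ← root (qM (V 0 + v)) (ha.trans hx).le]
    refine rpow_le_rpow (rpow_nonneg (ha.trans hx).le _) ?_ (by positivity)
    rw [one_div_mul_eq_div, le_div_iff₀ hc₁]
    linarith
  have hp₁ : ∀ v, d < v → c₃ * k₁ ^ (2 * l - 1) * v ^ ((2 * l - 1) / (2 * l)) ≤
      deriv V (qM (V 0 + v)) := by
    intro v hv
    have hv0 := hd.trans hv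
    refine le_trans ?_ (h₃ _ (hX v hv).1.le)
    have := rpow_le_rpow (by positivity) (hX₁ v hv) (show 0 ≤ 2 * l - 1 by linarith)
    rw [mul_rpow hk₁.le (by positivity), ← rpow_mul hv0.le, one_div_mul_eq_div] at this
    rw [mul_assoc]
    gcongr
  have hc := SymOn.comp_of_hasDerivAt_inv ha hd hk₁ (by positivity) (fun v hv => (hX v hv).1)
    hX₁ hX₂ hl0 (hV.symOn_deriv ha) hp₁ (fun v hv => hqM.hasDerivAt hV (hd.trans hv))
    (hV.symOn_deriv ha) n
  have := hc.inv hd (c := c₃ * k₁ ^ (2 * l - 1)) (by positivity) hp₁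
  rwa [show -((2 * l - 1) / (2 * l)) = 1 / (2 * l) - 1 by field_simp; ring] at this

end IsTurningPoint

/-- The part of the period away from the turning point is a symbol of order `-1/2`. -/
lemma symOn_integral_sub_rpow {a d b : ℝ} {U : ℝ → ℝ} (hd : 0 ≤ d) (hdb : d < b)
    (hU : Continuous U) (hUd : ∀ q ∈ Set.Ioc 0 a, U q ≤ d) (n : ℕ) :
    SymOn b n (-(1 / 2)) (fun e => ∫ q in Set.Ioc 0 a, (e - U q) ^ (-(1 / 2) : ℝ)) := by
  have hb : 0 < b := hd.trans_lt hdb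
  have k0 : 0 < 1 - d / b := by rw [sub_pos, div_lt_one hb]; exact hdb
  have k1 : ∀ e, b < e → ∀ q ∈ Set.Ioc 0 a, (1 - d / b) * e ≤ e - U q := by
    intro e he q hq
    have : d ≤ d / b * e := by
      rw [div_mul_eq_mul_div, le_div_iff₀ hb]
      exact mul_le_mul_of_nonneg_left he.le hd
    linarith [hUd q hq]
  have k2 : ∀ e, b < e → ∀ q ∈ Set.Ioc 0 a, 0 < e - U q := fun e he q hq =>
    (mul_pos k0 (hb.trans he)).trans_le (k1 e he q hq)
  have h := symOn_integral (volume.restrict (Set.Ioc 0 a)) (m := -(1 / 2)) hb (by norm_num)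
    (fun k e q => (∏ i ∈ Finset.range k, (-(1 / 2) - i : ℝ)) * (e - U q) ^ (-(1 / 2) - k : ℝ))
    (g := fun _ => 1) (integrable_const 1) (by simp) ?_ ?_ ?_ n 0
  · simpa using h
  · intro k e _
    exact Measurable.aestronglyMeasurable (by have := hU.measurable; fun_prop)
  · intro k
    filter_upwards [ae_restrict_mem measurableSet_Ioc] with q hq e he
    have := ((((hasDerivAt_id e).sub_const (U q)).rpow_const (p := (-(1 / 2) - k : ℝ))
      (Or.inl (k2 e he q hq).ne')).const_mul (∏ i ∈ Finset.range k, (-(1 / 2) - i : ℝ)))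
    refine this.congr_deriv ?_
    rw [Finset.prod_range_succ]
    simp only [id, one_mul]
    push_cast
    rw [← sub_sub, mul_assoc]
  · intro k
    refine ⟨|∏ i ∈ Finset.range k, (-(1 / 2) - i : ℝ)| * (1 - d / b) ^ (-(1 / 2) - k : ℝ),
      by positivity, ?_⟩
    filter_upwards [ae_restrict_mem measurableSet_Ioc] with q hq e he
    have he0 : 0 < e := hb.trans he
    rw [abs_mul, mul_one, mul_assoc, ← mul_rpow k0.le he0.le,
      abs_of_pos (rpow_pos_of_pos (k2 e he q hq) _)]
    refine mul_le_mul_of_nonneg_left ?_ (abs_nonneg _)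
    exact rpow_le_rpow_of_nonpos (mul_pos k0 he0) (k1 e he q hq)
      (by linarith [k.cast_nonneg (α := ℝ)])

lemma integrableOn_one_sub_rpow :
    IntegrableOn (fun s : ℝ => (1 - s) ^ (-(1 / 2) : ℝ)) (Set.Ioo 0 1) := by
  have h := (intervalIntegral.intervalIntegrable_rpow' (a := 0) (b := 1)
    (show (-1 : ℝ) < -(1 / 2) by norm_num)).comp_sub_left 1
  simp only [sub_zero, sub_self] at h
  exact ((intervalIntegrable_iff_integrableOn_Ioc_of_le zero_le_one).1 h.symm).mono_set
    Set.Ioo_subset_Ioc_self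

lemma rpow_mul_one_sub_rpow_le {m s : ℝ} (hm : m ≤ 0) (hm1 : -1 < m) (hs : s ∈ Set.Ioo (0 : ℝ) 1) :
    s ^ m * (1 - s) ^ (-(1 / 2) : ℝ) ≤ 2 * (s ^ m + (1 - s) ^ (-(1 / 2) : ℝ)) := by
  have key : ∀ x p : ℝ, 1 / 2 ≤ x → p ≤ 0 → -1 < p → x ^ p ≤ 2 := by
    intro x p hx hp hp1
    calc x ^ p ≤ (1 / 2) ^ p := rpow_le_rpow_of_nonpos (by norm_num) hx hp
      _ ≤ (1 / 2) ^ (-1 : ℝ) :=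
        rpow_le_rpow_of_exponent_ge (by norm_num) (by norm_num) hp1.le
      _ = 2 := by rw [rpow_neg_one]; norm_num
  have p1 : 0 < s ^ m := rpow_pos_of_pos hs.1 m
  have p2 : 0 < (1 - s) ^ (-(1 / 2) : ℝ) := rpow_pos_of_pos (by linarith [hs.2]) _
  rcases le_total (1 / 2) s with h | h
  · nlinarith [key s m h hm hm1]
  · nlinarith [key (1 - s) (-(1 / 2)) (by linarith) (by norm_num) (by norm_num)]

section Abel

variable {m d b : ℝ} {F : ℝ → ℝ}

lemma SymOn.measurable_abel (hF : ∀ n, SymOn d n m F) {e : ℝ} (he : d < e) (k : ℕ) :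
    AEStronglyMeasurable (fun s : ℝ => s ^ k * iteratedDeriv k F (d + (e - d) * s) *
      (1 - s) ^ (-(1 / 2) : ℝ)) (volume.restrict (Set.Ioo 0 1)) := by
  have h := ((SymOn.hasDerivAt_iteratedDeriv hF k).2 1).continuousOn
  refine ContinuousOn.aestronglyMeasurable (ContinuousOn.mul (ContinuousOn.mul (by fun_prop)
    (h.comp (by fun_prop) fun s hs => ?_)) fun s hs => ?_) measurableSet_Ioo
  · have := mul_pos (sub_pos.2 he) hs.1
    simp only [Set.mem_Ioi]
    linarith
  · exact (ContinuousAt.rpow_const (by fun_prop)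
      (Or.inl (by linarith [hs.2]))).continuousWithinAt

lemma integrable_rpow_add_one_sub_rpow (hm1 : -1 < m) :
    Integrable (fun s : ℝ => 2 * (s ^ m + (1 - s) ^ (-(1 / 2) : ℝ)))
      (volume.restrict (Set.Ioo 0 1)) :=
  ((((intervalIntegrable_iff_integrableOn_Ioc_of_le zero_le_one).1
    (intervalIntegral.intervalIntegrable_rpow' hm1)).mono_set Set.Ioo_subset_Ioc_self).add
      integrableOn_one_sub_rpow).const_mul 2

lemma SymOn.exists_abel_le (hd : 0 < d) (hdb : d < b) (hm : m ≤ 0) (hm1 : -1 < m)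
    (hF : ∀ n, SymOn d n m F) (k : ℕ) :
    ∃ C : ℝ, 0 ≤ C ∧ ∀ᵐ s ∂(volume.restrict (Set.Ioo (0 : ℝ) 1)), ∀ e, b < e →
      |s ^ k * iteratedDeriv k F (d + (e - d) * s) * (1 - s) ^ (-(1 / 2) : ℝ)| ≤
        C * e ^ (m - k) * (2 * (s ^ m + (1 - s) ^ (-(1 / 2) : ℝ))) := by
  have hb : 0 < b := hd.trans hdb
  have k0 : 0 < 1 - d / b := by rw [sub_pos, div_lt_one hb]; exact hdb
  obtain ⟨C, hC0, hC⟩ := ((SymOn.hasDerivAt_iteratedDeriv hF k).2 0).bound_nonneg hd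
  refine ⟨C * (1 - d / b) ^ (m - k), by positivity, ?_⟩
  filter_upwards [ae_restrict_mem measurableSet_Ioo] with s hs e he
  have hs0 : 0 < s := hs.1
  have he0 : 0 < e := hb.trans he
  have k1 : (1 - d / b) * e ≤ e - d := by
    have : d ≤ d / b * e := by
      rw [div_mul_eq_mul_div, le_div_iff₀ hb]
      exact mul_le_mul_of_nonneg_left he.le hd.le
    linarith
  have k2 : (1 - d / b) * e * s ≤ d + (e - d) * s := by
    have := mul_le_mul_of_nonneg_right k1 hs0.le
    linarith
  have hw : 0 < (1 - s) ^ (-(1 / 2) : ℝ) := rpow_pos_of_pos (by linarith [hs.2]) _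
  have h1 := hC (d + (e - d) * s) (by nlinarith)
  have h2 : (d + (e - d) * s) ^ (m - k) ≤ ((1 - d / b) * e * s) ^ (m - k) :=
    rpow_le_rpow_of_nonpos (by positivity) k2 (by linarith [k.cast_nonneg (α := ℝ)])
  have h3 : s ^ k * s ^ (m - k) = s ^ m := by
    rw [← rpow_natCast, ← rpow_add hs0]
    ring_nf
  rw [mul_rpow (by positivity) hs0.le, mul_rpow k0.le he0.le] at h2
  rw [abs_mul, abs_mul, abs_of_pos hw, abs_of_pos (pow_pos hs0 k)]
  calc s ^ k * |iteratedDeriv k F (d + (e - d) * s)| * (1 - s) ^ (-(1 / 2) : ℝ)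
      ≤ s ^ k * (C * ((1 - d / b) ^ (m - k) * e ^ (m - k) * s ^ (m - k))) *
          (1 - s) ^ (-(1 / 2) : ℝ) := by
        gcongr
        exact h1.trans (mul_le_mul_of_nonneg_left h2 hC0)
    _ = C * (1 - d / b) ^ (m - k) * e ^ (m - k) * (s ^ k * s ^ (m - k) *
          (1 - s) ^ (-(1 / 2) : ℝ)) := by ring
    _ ≤ _ := by
        rw [h3]
        exact mul_le_mul_of_nonneg_left (rpow_mul_one_sub_rpow_le hm hm1 hs) (by positivity)

/-- Rescaled Abel transforms preserve symbol classes. -/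
lemma SymOn.abel (hd : 0 < d) (hdb : d < b) (hm : m ≤ 0) (hm1 : -1 < m)
    (hF : ∀ n, SymOn d n m F) (n : ℕ) :
    SymOn b n m (fun e => ∫ s in Set.Ioo 0 1, F (d + (e - d) * s) * (1 - s) ^ (-(1 / 2) : ℝ)) := by
  have h := symOn_integral (volume.restrict (Set.Ioo 0 1)) (m := m) (hd.trans hdb) hm
    (fun k e s => s ^ k * iteratedDeriv k F (d + (e - d) * s) * (1 - s) ^ (-(1 / 2) : ℝ))
    (integrable_rpow_add_one_sub_rpow hm1) ?_
    (fun k e he => SymOn.measurable_abel hF (hdb.trans he) k) ?_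
    (SymOn.exists_abel_le hd hdb hm hm1 hF) n 0
  · simpa using h
  · filter_upwards [ae_restrict_mem measurableSet_Ioo] with s hs
    have := rpow_nonneg hs.1.le m
    have := rpow_nonneg (show 0 ≤ 1 - s by linarith [hs.2]) (-(1 / 2))
    positivity
  · intro k
    filter_upwards [ae_restrict_mem measurableSet_Ioo] with s hs e he
    have hin : HasDerivAt (fun e => d + (e - d) * s) s e := by
      simpa using (((hasDerivAt_id e).sub_const d).mul_const s).const_add d
    have hlt : d < d + (e - d) * s := by
      have := mul_pos (sub_pos.2 (hdb.trans he)) hs.1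
      linarith
    have := ((((SymOn.hasDerivAt_iteratedDeriv hF k).1 _ hlt).comp e hin).const_mul
      (s ^ k)).mul_const ((1 - s) ^ (-(1 / 2) : ℝ))
    refine this.congr_deriv ?_
    ring

lemma SymOn.integrable_abel (hd : 0 < d) (hm : m ≤ 0) (hm1 : -1 < m)
    (hF : ∀ n, SymOn d n m F) {e : ℝ} (he : d < e) :
    IntegrableOn (fun s => F (d + (e - d) * s) * (1 - s) ^ (-(1 / 2) : ℝ)) (Set.Ioo 0 1) := by
  obtain ⟨b, hdb, hbe⟩ := exists_between he
  obtain ⟨C, -, hC⟩ := SymOn.exists_abel_le hd hdb hm hm1 hF 0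
  have hmeas := SymOn.measurable_abel hF he 0
  simp only [pow_zero, one_mul, iteratedDeriv_zero] at hC hmeas
  refine Integrable.mono' ((integrable_rpow_add_one_sub_rpow hm1).const_mul
    (C * e ^ (m - (0 : ℕ)))) hmeas ?_
  filter_upwards [hC] with s hs using hs e hbe

end Abel

/-- Splitting of the period integral: the part of the orbit near the turning point is
parametrized by the potential energy. -/
lemma integral_inv_sqrt_sub {V X F : ℝ → ℝ} {a d e : ℝ} (hV : Continuous V)
    (hmono : StrictMonoOn V (Set.Ici 0)) (ha : 0 < a) (hVa : V a = V 0 + d) (he : d < e)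
    (hX : ∀ v, d < v → a < X v ∧ V (X v) = V 0 + v)
    (hXF : ∀ v, d < v → HasDerivAt X (F v) v) (hF : ∀ v, d < v → 0 < F v)
    (hFint : IntegrableOn (fun s => F (d + (e - d) * s) * (1 - s) ^ (-(1 / 2) : ℝ)) (Set.Ioo 0 1)) :
    ∫ q in (0 : ℝ)..(X e), (√(V 0 + e - V q))⁻¹ =
      (∫ q in Set.Ioc 0 a, (e - (V q - V 0)) ^ (-(1 / 2) : ℝ)) +
        (e - d) ^ (1 / 2 : ℝ) *
          ∫ s in Set.Ioo 0 1, F (d + (e - d) * s) * (1 - s) ^ (-(1 / 2) : ℝ) := by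
  have hed : 0 < e - d := sub_pos.2 he
  have hlt : ∀ s ∈ Set.Ioo (0 : ℝ) 1, d < d + (e - d) * s := fun s hs => by
    have := mul_pos hed hs.1
    linarith
  have hder : ∀ s ∈ Set.Ioo (0 : ℝ) 1, HasDerivWithinAt (fun s => X (d + (e - d) * s))
      (F (d + (e - d) * s) * (e - d)) (Set.Ioo 0 1) s := by
    intro s hs
    have hin : HasDerivAt (fun s => d + (e - d) * s) (e - d) s := by
      simpa using ((hasDerivAt_id s).const_mul (e - d)).const_add d
    exact ((hXF _ (hlt s hs)).comp s hin).hasDerivWithinAt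
  have hinj : Set.InjOn (fun s => X (d + (e - d) * s)) (Set.Ioo 0 1) := by
    intro s hs t ht hst
    have h1 := (hX _ (hlt s hs)).2
    have h2 := (hX _ (hlt t ht)).2
    simp only at hst
    rw [hst, h2] at h1
    have : (e - d) * t = (e - d) * s := by linarith
    exact (mul_left_cancel₀ hed.ne' this).symm
  have himg : (fun s => X (d + (e - d) * s)) '' Set.Ioo 0 1 = Set.Ioo a (X e) := by
    ext q
    constructor
    · rintro ⟨s, hs, rfl⟩
      obtain ⟨h1, h2⟩ := hX _ (hlt s hs)
      obtain ⟨h3, h4⟩ := hX e he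
      refine ⟨h1, ?_⟩
      rw [← hmono.lt_iff_lt (Set.mem_Ici.2 (ha.trans h1).le) (Set.mem_Ici.2 (ha.trans h3).le),
        h2, h4]
      have := mul_lt_mul_of_pos_left hs.2 hed
      linarith
    · rintro ⟨h1, h2⟩
      have hq : q ∈ Set.Ici (0 : ℝ) := (ha.trans h1).le
      have hXe : X e ∈ Set.Ici (0 : ℝ) := (ha.trans (hX e he).1).le
      have h3 := hmono (Set.mem_Ici.2 ha.le) hq h1
      have h4 := hmono hq hXe h2
      rw [(hX e he).2] at h4
      rw [hVa] at h3
      have harg : d + (e - d) * ((V q - V 0 - d) / (e - d)) = V q - V 0 := by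
        field_simp
        ring
      refine ⟨(V q - V 0 - d) / (e - d), ⟨div_pos (by linarith) hed, ?_⟩, ?_⟩
      · rw [div_lt_one hed]
        linarith
      · simp only [harg]
        obtain ⟨h5, h6⟩ := hX (V q - V 0) (by linarith)
        exact hmono.injOn (Set.mem_Ici.2 (ha.trans h5).le) hq (by rw [h6]; ring)
  have hsub : ∀ s ∈ Set.Ioo (0 : ℝ) 1, |F (d + (e - d) * s) * (e - d)| •
      (√(V 0 + e - V (X (d + (e - d) * s))))⁻¹ =
      (e - d) ^ (1 / 2 : ℝ) * (F (d + (e - d) * s) * (1 - s) ^ (-(1 / 2) : ℝ)) := by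
    intro s hs
    have h1s : 0 < 1 - s := by linarith [hs.2]
    rw [abs_of_pos (mul_pos (hF _ (hlt s hs)) hed), (hX _ (hlt s hs)).2, smul_eq_mul,
      show V 0 + e - (V 0 + (d + (e - d) * s)) = (e - d) * (1 - s) by ring,
      Real.sqrt_mul hed.le, ← Real.sqrt_eq_rpow, rpow_neg h1s.le, ← Real.sqrt_eq_rpow, mul_inv]
    have h5 := Real.sqrt_pos.2 hed
    have h6 := Real.mul_self_sqrt hed.le
    field_simp
    linear_combination -F (d + (e - d) * s) * h6
  have hI1 : IntervalIntegrable (fun q => (√(V 0 + e - V q))⁻¹) volume 0 a := by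
    refine ContinuousOn.intervalIntegrable (ContinuousOn.inv₀ (by fun_prop) fun q hq => ?_)
    rw [Set.uIcc_of_le ha.le] at hq
    have := hmono.monotoneOn (Set.mem_Ici.2 hq.1) (Set.mem_Ici.2 ha.le) hq.2
    exact (Real.sqrt_pos.2 (by linarith)).ne'
  have hI2 : IntervalIntegrable (fun q => (√(V 0 + e - V q))⁻¹) volume a (X e) := by
    rw [intervalIntegrable_iff_integrableOn_Ioo_of_le (hX e he).1.le, ← himg,
      integrableOn_image_iff_integrableOn_abs_deriv_smul measurableSet_Ioo hder hinj]
    exact IntegrableOn.congr_fun (hFint.const_mul _) (fun s hs => (hsub s hs).symm) measurableSet_Ioo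
  rw [← intervalIntegral.integral_add_adjacent_intervals hI1 hI2,
    intervalIntegral.integral_of_le ha.le, intervalIntegral.integral_of_le (hX e he).1.le,
    integral_Ioc_eq_integral_Ioo (x := a), ← himg,
    integral_image_eq_integral_abs_deriv_smul measurableSet_Ioo hder hinj,
    setIntegral_congr_fun measurableSet_Ioo hsub, MeasureTheory.integral_const_mul]
  congr 1
  refine setIntegral_congr_fun measurableSet_Ioc fun q hq => ?_
  have := hmono.monotoneOn (Set.mem_Ici.2 hq.1.le) (Set.mem_Ici.2 ha.le) hq.2
  rw [rpow_neg (by linarith), ← Real.sqrt_eq_rpow, show V 0 + e - V q = e - (V q - V 0) by ring]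

/-- The period, as a function of the energy above the minimum of the potential, is a symbol. -/
lemma symOn_period {l : ℝ} (hl : 1 ≤ l) {V : ℝ → ℝ} (hV : GoodPotential l V)
    {qM : ℝ → ℝ} (hqM : IsTurningPoint V qM) {b : ℝ} (hb : 0 < b) (n : ℕ) :
    SymOn b n ((1 - l) / (2 * l)) (fun e => period V qM (V 0 + e)) := by
  obtain ⟨d, hd, hdb⟩ := exists_between hb
  obtain ⟨ha, hVa, -⟩ := hqM (V 0 + d) (by linarith)
  set a := qM (V 0 + d)
  have hmono := hV.strictMonoOn hqM
  have hX : ∀ v, d < v → a < qM (V 0 + v) ∧ V (qM (V 0 + v)) = V 0 + v := by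
    intro v hv
    obtain ⟨hp, hVp, -⟩ := hqM (V 0 + v) (by linarith)
    refine ⟨?_, hVp⟩
    rw [← hmono.lt_iff_lt (Set.mem_Ici.2 ha.le) (Set.mem_Ici.2 hp.le), hVa, hVp]
    linarith
  have hl0 : 0 < l := by linarith
  have hm : 1 / (2 * l) - 1 ≤ 0 := by
    rw [sub_nonpos, div_le_one (by linarith)]
    linarith
  have hm1 : -1 < 1 / (2 * l) - 1 := by
    have : 0 < 1 / (2 * l) := by positivity
    linarith
  have hF := hqM.symOn_inv_deriv hV hl hd
  have h1 : SymOn b n ((1 - l) / (2 * l)) _ :=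
    (symOn_integral_sub_rpow (a := a) (U := fun q => V q - V 0) hd.le hdb
    (hV.smooth.continuous.sub continuous_const) (fun q hq => by
      have := hmono.monotoneOn (Set.mem_Ici.2 hq.1.le) (Set.mem_Ici.2 ha.le) hq.2
      linarith) n).mono_order hb (by rw [le_div_iff₀ (by linarith)]; linarith)
  have h2 := (SymOn.sub_rpow hd.le hdb (1 / 2) n).mul hb (SymOn.abel hd hdb hm hm1 hF n)
  rw [show 1 / 2 + (1 / (2 * l) - 1) = (1 - l) / (2 * l) by field_simp; ring] at h2
  have h3 := (SymOn.const 4).mul hb (h1.add h2)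
  rw [zero_add] at h3
  refine h3.congr fun e he => ?_
  rw [period]
  congr 1
  refine integral_inv_sqrt_sub (X := fun v => qM (V 0 + v)) hV.smooth.continuous hmono ha hVa
    (hdb.trans he) hX (fun v hv => hqM.hasDerivAt hV (hd.trans hv)) (fun v hv => ?_)
    (SymOn.integrable_abel hd hm hm1 hF (hdb.trans he))
  exact inv_pos.2 (hV.deriv_pos hqM (ha.trans (hX v hv).1))

/-- the cutoff period `η(E)T(E)` is `C^∞` on `ℝ` and of class `S̃^{1-l}`:
`|∂_E^k(η T)(E)| ≤ C_k ⟨E⟩^{(1-l)/(2l) - k}`. -/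
theorem stmt4 (l : ℝ) (hl : 1 ≤ l) (V : ℝ → ℝ) (hV : GoodPotential l V)
    (qM : ℝ → ℝ) (hqM : IsTurningPoint V qM)
    (E₁ E₂ : ℝ) (hE₁ : V 0 < E₁) (hE₁₂ : E₁ < E₂)
    (η : ℝ → ℝ) (hη : ContDiff ℝ (⊤ : ℕ∞) η)
    (hη0 : ∀ E : ℝ, E ≤ E₁ → η E = 0) (hη1 : ∀ E : ℝ, E₂ ≤ E → η E = 1) :
    ContDiff ℝ (⊤ : ℕ∞) (fun E => η E * period V qM E) ∧
    ∀ k : ℕ, ∃ C : ℝ, ∀ E : ℝ,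
      |iteratedDeriv k (fun E' => η E' * period V qM E') E|
        ≤ C * jap E ^ ((1 - l) / (2 * l) - (k : ℝ)) := by
  obtain ⟨b, hb, hbE⟩ := exists_between (sub_pos.2 hE₁)
  have hT := symOn_period hl hV hqM hb
  have hsmooth : ContDiff ℝ (⊤ : ℕ∞) (fun E => η E * period V qM E) := by
    rw [contDiff_iff_contDiffAt]
    intro E
    rcases lt_or_ge E E₁ with hE | hE
    · refine contDiffAt_const (c := (0 : ℝ)) |>.congr_of_eventuallyEq ?_
      filter_upwards [gt_mem_nhds hE] with x hx
      rw [hη0 x (le_of_lt hx), zero_mul]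
    · refine hη.contDiffAt.mul ?_
      have h1 := (SymOn.contDiffOn hT).contDiffAt (Ioi_mem_nhds (show b < E - V 0 by linarith))
      have h2 := h1.comp E ((contDiff_id.sub contDiff_const).contDiffAt (f := fun x => x - V 0))
      simpa [Function.comp_def] using h2
  refine ⟨hsmooth, fun k => ?_⟩
  have hp : (1 - l) / (2 * l) - k ≤ 0 := by
    have : (1 - l) / (2 * l) ≤ 0 := div_nonpos_of_nonpos_of_nonneg (by linarith) (by linarith)
    linarith [k.cast_nonneg (α := ℝ)]
  set p := (1 - l) / (2 * l) - k
  obtain ⟨C, hC0, hC⟩ := ((SymOn.hasDerivAt_iteratedDeriv hT k).2 0).bound_nonneg hb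
  set M := max E₂ (max (2 * |V 0|) 1)
  have hM : E₂ ≤ M := le_max_left _ _
  have hcont : Continuous fun E => iteratedDeriv k (fun E' => η E' * period V qM E') E / jap E ^ p :=
    (hsmooth.continuous_iteratedDeriv k (by exact_mod_cast le_top)).div
      (continuous_jap.rpow_const fun E => Or.inl (jap_pos E).ne')
      fun E => (rpow_pos_of_pos (jap_pos E) p).ne'
  obtain ⟨D, hD⟩ := (isCompact_Icc (a := E₁) (b := M)).exists_bound_of_continuousOn
    hcont.continuousOn
  refine ⟨max 0 (max D (C * (1 / 4) ^ p)), fun E => ?_⟩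
  have hj := rpow_pos_of_pos (jap_pos E) p
  rcases lt_or_ge E E₁ with hE | hE
  · have : (fun E' => η E' * period V qM E') =ᶠ[nhds E] fun _ => 0 := by
      filter_upwards [gt_mem_nhds hE] with x hx
      rw [hη0 x (le_of_lt hx), zero_mul]
    rw [this.iteratedDeriv_eq k]
    simp only [iteratedDeriv_const, ite_self, abs_zero]
    positivity
  rcases le_or_gt E M with hEM | hEM
  · have := hD E ⟨hE, hEM⟩
    rw [Real.norm_eq_abs, abs_div, abs_of_pos hj, div_le_iff₀ hj] at this
    refine this.trans (mul_le_mul_of_nonneg_right ?_ hj.le)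
    exact (le_max_left _ _).trans (le_max_right _ _)
  · have h1 : (fun E' => η E' * period V qM E') =ᶠ[nhds E]
        fun E' => (fun e => period V qM (V 0 + e)) (E' - V 0) := by
      filter_upwards [lt_mem_nhds (hM.trans_lt hEM)] with x hx
      rw [hη1 x (le_of_lt hx), one_mul, add_sub_cancel]
    rw [h1.iteratedDeriv_eq k,
      congrFun (iteratedDeriv_comp_sub_const k (fun e => period V qM (V 0 + e)) (V 0)) E]
    refine (hC _ (by linarith)).trans ?_
    have hE1 : 1 < E := ((le_max_right _ _).trans (le_max_right _ _)).trans_lt hEM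
    have hEV : 2 * |V 0| < E := ((le_max_left _ _).trans (le_max_right _ _)).trans_lt hEM
    have h2 : 1 / 4 * jap E ≤ E - V 0 := by
      linarith [jap_le_one_add (show 0 ≤ E by linarith), le_abs_self (V 0)]
    have h3 := rpow_le_rpow_of_nonpos (mul_pos (by norm_num) (jap_pos E)) h2 hp
    rw [mul_rpow (by norm_num) (jap_pos E).le] at h3
    calc C * (E - V 0) ^ p ≤ C * ((1 / 4) ^ p * jap E ^ p) := mul_le_mul_of_nonneg_left h3 hC0
      _ = C * (1 / 4) ^ p * jap E ^ p := by ring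
      _ ≤ _ := mul_le_mul_of_nonneg_right
        ((le_max_right _ _).trans (le_max_right _ _)) hj.le
end
end

section
/- Let l = 1, λ(x,ξ) := (1+x²+ξ²)^{1/2}, ⟨x⟩ := √(1+x²), and let R_t(x,ξ) := (x cos t + ξ sin t, ξ cos t − x sin t) be the rotation flow of the harmonic oscillator. Let m₁,m₂ ∈ ℝ, α ∈ ℝ, and let p ∈ C^∞(ℝ²) satisfy |∂_ξ^{k₁}∂_x^{k₂} p(x,ξ)| ≤ C_{k₁,k₂} λ(x,ξ)^{m₁−k₁} ⟨x⟩^{m₂−k₂} for all k₁,k₂ ≥ 0. Define I(x,ξ) := ∫₀^{2π} e^{iαt} p(R_t(x,ξ)) dt. Then I ∈ S^{m₁+[m₂],0}, i.e. |∂_ξ^{k₁}∂_x^{k₂} I(x,ξ)| ≤ C′_{k₁,k₂} λ(x,ξ)^{m₁+[m₂]−k₁} ⟨x⟩^{−k₂} for all k₁,k₂ ≥ 0, and moreover ∂_x I ∈ S^{m₁+[m₂]−1,0}, i.e. |∂_ξ^{k₁}∂_x^{k₂} ∂_x I(x,ξ)| ≤ C″_{k₁,k₂} λ(x,ξ)^{m₁+[m₂]−1−k₁}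 ⟨x⟩^{−k₂}. -/
open Real MeasureTheory intervalIntegral

noncomputable section

/-- `I(x,ξ) = ∫₀^{2π} e^{iαt} p(R_t(x,ξ)) dt`, where `R_t` is the rotation flow of the
harmonic oscillator. -/
def Iosc (α : ℝ) (p : ℝ → ℝ → ℝ) (x ξ : ℝ) : ℂ :=
  ∫ t in (0:ℝ)..(2 * π), Complex.exp (α * t * Complex.I) *
    (p (x * Real.cos t + ξ * Real.sin t) (ξ * Real.cos t - x * Real.sin t) : ℂ)

open scoped ContDiff

theorem hasFDerivAt_intervalIntegral_of_continuous {H E : Type*} [NormedAddCommGroup H]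
    [NormedSpace ℝ H] [ProperSpace H] [NormedAddCommGroup E] [NormedSpace ℝ E]
    {F : H → ℝ → E} {F' : H → ℝ → H →L[ℝ] E}
    (hF : Continuous fun z : H × ℝ => F z.1 z.2) (hF' : Continuous fun z : H × ℝ => F' z.1 z.2)
    (h : ∀ x t, HasFDerivAt (fun y => F y t) (F' x t) x) (a b : ℝ) (x : H) :
    HasFDerivAt (fun y => ∫ t in a..b, F y t) (∫ t in a..b, F' x t) x := by
  have hc (y : H) : Continuous (F y) := hF.comp (by fun_prop : Continuous fun t : ℝ => (y, t))
  have hc' (y : H) : Continuous (F' y) := hF'.comp (by fun_prop : Continuous fun t : ℝ => (y, t))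
  obtain ⟨C, hC⟩ := ((isCompact_closedBall x 1).prod
    (isCompact_uIcc (a := a) (b := b))).exists_bound_of_continuousOn hF'.continuousOn
  refine (intervalIntegral.hasFDerivAt_integral_of_dominated_of_fderiv_le (𝕜 := ℝ)
    (bound := fun _ => C) (Metric.closedBall_mem_nhds x one_pos)
    (.of_forall fun y => (hc y).aestronglyMeasurable) ((hc x).intervalIntegrable _ _)
    (hc' x).aestronglyMeasurable ?_ intervalIntegrable_const ?_)
  · exact .of_forall fun t ht y hy => hC (y, t) ⟨hy, Set.uIoc_subset_uIcc ht⟩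
  · exact .of_forall fun t _ y _ => h y t

theorem contDiff_intervalIntegral.{u} {H : Type u} [NormedAddCommGroup H] [NormedSpace ℝ H]
    [ProperSpace H] (a b : ℝ) (n : ℕ) :
    ∀ {E : Type u} [NormedAddCommGroup E] [NormedSpace ℝ E] {F : H → ℝ → E},
      ContDiff ℝ ∞ (fun z : H × ℝ => F z.1 z.2) →
      ContDiff ℝ n fun x => ∫ t in a..b, F x t := by
  induction n with
  | zero =>
    intro E _ _ F hF
    exact contDiff_zero.2 (intervalIntegral.continuous_parametric_intervalIntegral_of_continuous'
      (f := F) hF.continuous a b)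
  | succ n ih =>
    intro E _ _ F hF
    set F' : H → ℝ → H →L[ℝ] E := fun x t =>
      (fderiv ℝ (fun z : H × ℝ => F z.1 z.2) (x, t)).comp (ContinuousLinearMap.inl ℝ H ℝ)
    have hF' : ContDiff ℝ ∞ (fun z : H × ℝ => F' z.1 z.2) :=
      (hF.fderiv_right (m := ∞) le_rfl).clm_comp contDiff_const
    have h (x : H) (t : ℝ) : HasFDerivAt (fun y => F y t) (F' x t) x :=
      HasFDerivAt.comp (g := fun z : H × ℝ => F z.1 z.2) (f := fun y => (y, t)) x
        ((hF.differentiable (by simp)) (x, t)).hasFDerivAt (hasFDerivAt_prodMk_left x t)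
    push_cast
    exact (contDiff_succ_iff_hasFDerivAt (n := n)).2 ⟨_, ih hF',
      hasFDerivAt_intervalIntegral_of_continuous hF.continuous hF'.continuous h a b⟩

/-- The partial derivative in the first variable. -/
def dX {E : Type*} [NormedAddCommGroup E] [NormedSpace ℝ E] (f : ℝ × ℝ → E) (q : ℝ × ℝ) : E :=
  fderiv ℝ f q (1, 0)

/-- The partial derivative in the second variable. -/
def dY {E : Type*} [NormedAddCommGroup E] [NormedSpace ℝ E] (f : ℝ × ℝ → E) (q : ℝ × ℝ) : E :=
  fderiv ℝ f q (0, 1)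

section PartialDerivatives

variable {E : Type*} [NormedAddCommGroup E] [NormedSpace ℝ E] {f g : ℝ × ℝ → E}

theorem ContDiff.dX (hf : ContDiff ℝ ∞ f) : ContDiff ℝ ∞ (dX f) :=
  (hf.fderiv_right (m := ∞) le_rfl).clm_apply contDiff_const

theorem ContDiff.dY (hf : ContDiff ℝ ∞ f) : ContDiff ℝ ∞ (dY f) :=
  (hf.fderiv_right (m := ∞) le_rfl).clm_apply contDiff_const

theorem ContDiff.dX_iterate (hf : ContDiff ℝ ∞ f) (k : ℕ) : ContDiff ℝ ∞ (_root_.dX^[k] f) := by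
  induction k with
  | zero => exact hf
  | succ k ih => rw [Function.iterate_succ_apply']; exact ih.dX

theorem ContDiff.dY_iterate (hf : ContDiff ℝ ∞ f) (k : ℕ) : ContDiff ℝ ∞ (_root_.dY^[k] f) := by
  induction k with
  | zero => exact hf
  | succ k ih => rw [Function.iterate_succ_apply']; exact ih.dY

theorem dX_eq_deriv (hf : ContDiff ℝ ∞ f) (x y : ℝ) :
    dX f (x, y) = deriv (fun x' => f (x', y)) x := by
  have h : HasDerivAt (fun x' : ℝ => (x', y)) ((1 : ℝ), (0 : ℝ)) x :=
    (hasDerivAt_id x).prodMk (hasDerivAt_const x y)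
  exact (HasFDerivAt.comp_hasDerivAt (f := fun x' : ℝ => (x', y)) x
    ((hf.differentiable (by simp)) (x, y)).hasFDerivAt h).deriv.symm

theorem dY_eq_deriv (hf : ContDiff ℝ ∞ f) (x y : ℝ) :
    dY f (x, y) = deriv (fun y' => f (x, y')) y := by
  have h : HasDerivAt (fun y' : ℝ => (x, y')) ((0 : ℝ), (1 : ℝ)) y :=
    (hasDerivAt_const y x).prodMk (hasDerivAt_id y)
  exact (HasFDerivAt.comp_hasDerivAt (f := fun y' : ℝ => (x, y')) y
    ((hf.differentiable (by simp)) (x, y)).hasFDerivAt h).deriv.symm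

theorem dX_iterate_eq_iteratedDeriv (hf : ContDiff ℝ ∞ f) (k : ℕ) (x y : ℝ) :
    dX^[k] f (x, y) = iteratedDeriv k (fun x' => f (x', y)) x := by
  induction k generalizing x with
  | zero => rfl
  | succ k ih =>
    rw [Function.iterate_succ_apply', dX_eq_deriv (hf.dX_iterate k), iteratedDeriv_succ]
    exact congrArg (fun h => deriv h x) (funext ih)

theorem dY_iterate_eq_iteratedDeriv (hf : ContDiff ℝ ∞ f) (k : ℕ) (x y : ℝ) :
    dY^[k] f (x, y) = iteratedDeriv k (fun y' => f (x, y')) y := by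
  induction k generalizing y with
  | zero => rfl
  | succ k ih =>
    rw [Function.iterate_succ_apply', dY_eq_deriv (hf.dY_iterate k), iteratedDeriv_succ]
    exact congrArg (fun h => deriv h y) (funext ih)

theorem iteratedDeriv_iteratedDeriv_eq (hf : ContDiff ℝ ∞ f) (k₁ k₂ : ℕ) (x y : ℝ) :
    iteratedDeriv k₁ (fun y' => iteratedDeriv k₂ (fun x' => f (x', y')) x) y
      = dY^[k₁] (dX^[k₂] f) (x, y) := by
  rw [dY_iterate_eq_iteratedDeriv (hf.dX_iterate k₂)]
  simp only [dX_iterate_eq_iteratedDeriv hf]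

theorem dX_dY_comm (hf : ContDiff ℝ ∞ f) : dX (dY f) = dY (dX f) := by
  funext q
  have hd : DifferentiableAt ℝ (fderiv ℝ f) q :=
    ((hf.fderiv_right (m := ∞) le_rfl).differentiable (by simp)) q
  have hs : IsSymmSndFDerivAt ℝ f q := hf.contDiffAt.isSymmSndFDerivAt 
    (by simpa using (mod_cast le_top : ((2 : ℕ∞) : WithTop ℕ∞) ≤ ((⊤ : ℕ∞) : WithTop ℕ∞)))
  have h (u v : ℝ × ℝ) : fderiv ℝ (fun z => fderiv ℝ f z u) q v = fderiv ℝ (fderiv ℝ f) q v u := by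
    rw [fderiv_clm_apply hd (differentiableAt_const u)]
    simp
  calc dX (dY f) q = fderiv ℝ (fderiv ℝ f) q (1, 0) (0, 1) := h (0, 1) (1, 0)
    _ = fderiv ℝ (fderiv ℝ f) q (0, 1) (1, 0) := hs _ _
    _ = dY (dX f) q := (h (1, 0) (0, 1)).symm

theorem dX_iterate_dY (hf : ContDiff ℝ ∞ f) (k : ℕ) : dX^[k] (dY f) = dY (dX^[k] f) := by
  induction k with
  | zero => rfl
  | succ k ih =>
    rw [Function.iterate_succ_apply', ih, dX_dY_comm (hf.dX_iterate k),
      Function.iterate_succ_apply']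

theorem fderiv_apply_eq_dX_add_dY (f : ℝ × ℝ → E) (q v : ℝ × ℝ) :
    fderiv ℝ f q v = v.1 • dX f q + v.2 • dY f q := by
  rw [dX, dY, ← map_smul, ← map_smul, ← map_add]
  simp

theorem dX_add (hf : ContDiff ℝ ∞ f) (hg : ContDiff ℝ ∞ g) :
    dX (fun q => f q + g q) = fun q => dX f q + dX g q := by
  funext q
  simp only [dX]
  rw [fderiv_fun_add ((hf.differentiable (by simp)) q) ((hg.differentiable (by simp)) q)]
  rfl

theorem dY_add (hf : ContDiff ℝ ∞ f) (hg : ContDiff ℝ ∞ g) :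
    dY (fun q => f q + g q) = fun q => dY f q + dY g q := by
  funext q
  simp only [dY]
  rw [fderiv_fun_add ((hf.differentiable (by simp)) q) ((hg.differentiable (by simp)) q)]
  rfl

end PartialDerivatives

section ComplexValued

variable {f g : ℝ × ℝ → ℂ}

theorem dX_mul (hf : ContDiff ℝ ∞ f) (hg : ContDiff ℝ ∞ g) :
    dX (fun q => f q * g q) = fun q => dX f q * g q + f q * dX g q := by
  funext q
  simp only [dX]
  rw [fderiv_fun_mul ((hf.differentiable (by simp)) q) ((hg.differentiable (by simp)) q)]
  simp [mul_comm, add_comm]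

theorem dY_mul (hf : ContDiff ℝ ∞ f) (hg : ContDiff ℝ ∞ g) :
    dY (fun q => f q * g q) = fun q => dY f q * g q + f q * dY g q := by
  funext q
  simp only [dY]
  rw [fderiv_fun_mul ((hf.differentiable (by simp)) q) ((hg.differentiable (by simp)) q)]
  simp [mul_comm, add_comm]

theorem dX_ofReal {f : ℝ × ℝ → ℝ} (hf : ContDiff ℝ ∞ f) :
    dX (fun q => (f q : ℂ)) = fun q => ((dX f q : ℝ) : ℂ) := by
  funext q
  exact congrArg (fun L : ℝ × ℝ →L[ℝ] ℂ => L (1, 0)) (Complex.ofRealCLM.hasFDerivAt.comp q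
    ((hf.differentiable (by simp)) q).hasFDerivAt).fderiv

theorem dY_ofReal {f : ℝ × ℝ → ℝ} (hf : ContDiff ℝ ∞ f) :
    dY (fun q => (f q : ℂ)) = fun q => ((dY f q : ℝ) : ℂ) := by
  funext q
  exact congrArg (fun L : ℝ × ℝ →L[ℝ] ℂ => L (0, 1)) (Complex.ofRealCLM.hasFDerivAt.comp q
    ((hf.differentiable (by simp)) q).hasFDerivAt).fderiv

theorem dX_const {E : Type*} [NormedAddCommGroup E] [NormedSpace ℝ E] (c : E) :
    dX (fun _ => c) = fun _ => 0 := by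
  funext q
  simp [dX]

theorem dY_const {E : Type*} [NormedAddCommGroup E] [NormedSpace ℝ E] (c : E) :
    dY (fun _ => c) = fun _ => 0 := by
  funext q
  simp [dY]

theorem dX_fst : dX (fun q : ℝ × ℝ => (q.1 : ℂ)) = fun _ => 1 := by
  rw [dX_ofReal (f := Prod.fst) contDiff_fst]
  funext q
  simp [dX, fderiv_fst]

theorem dY_fst : dY (fun q : ℝ × ℝ => (q.1 : ℂ)) = fun _ => 0 := by
  rw [dY_ofReal (f := Prod.fst) contDiff_fst]
  funext q
  simp [dY, fderiv_fst]

theorem dX_snd : dX (fun q : ℝ × ℝ => (q.2 : ℂ)) = fun _ => 0 := by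
  rw [dX_ofReal (f := Prod.snd) contDiff_snd]
  funext q
  simp [dX, fderiv_snd]

theorem dY_snd : dY (fun q : ℝ × ℝ => (q.2 : ℂ)) = fun _ => 1 := by
  rw [dY_ofReal (f := Prod.snd) contDiff_snd]
  funext q
  simp [dY, fderiv_snd]

end ComplexValued

/-- The weight `λ(x,ξ)^a ⟨x⟩^b`. -/
def symbolWeight (a b : ℝ) (q : ℝ × ℝ) : ℝ :=
  √(1 + q.1 ^ 2 + q.2 ^ 2) ^ a * √(1 + q.1 ^ 2) ^ b

/-- The symbol estimates of orders `(a, b)`, for all partial derivatives of order at most `N`. -/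
def SymbolUpTo : ℕ → ℝ → ℝ → (ℝ × ℝ → ℂ) → Prop
  | 0, a, b, f => ∃ C, ∀ q, ‖f q‖ ≤ C * symbolWeight a b q
  | N + 1, a, b, f => (∃ C, ∀ q, ‖f q‖ ≤ C * symbolWeight a b q) ∧
      SymbolUpTo N a (b - 1) (dX f) ∧ SymbolUpTo N (a - 1) b (dY f)

theorem one_le_japanese (x : ℝ) : 1 ≤ √(1 + x ^ 2) :=
  Real.one_le_sqrt.2 (by nlinarith [sq_nonneg x])

theorem japanese_le (q : ℝ × ℝ) : √(1 + q.1 ^ 2) ≤ √(1 + q.1 ^ 2 + q.2 ^ 2) :=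
  Real.sqrt_le_sqrt (by nlinarith [sq_nonneg q.2])

theorem symbolWeight_pos (a b : ℝ) (q : ℝ × ℝ) : 0 < symbolWeight a b q := by
  have h₁ := one_le_japanese q.1
  have h₂ := japanese_le q
  exact mul_pos (Real.rpow_pos_of_pos (by linarith) _) (Real.rpow_pos_of_pos (by linarith) _)

theorem symbolWeight_mul (a b a' b' : ℝ) (q : ℝ × ℝ) :
    symbolWeight a b q * symbolWeight a' b' q = symbolWeight (a + a') (b + b') q := by
  have h₁ := one_le_japanese q.1
  have h₂ := japanese_le q
  rw [symbolWeight, symbolWeight, symbolWeight, Real.rpow_add (by linarith),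
    Real.rpow_add (by linarith)]
  ring

theorem symbolWeight_le {a b a' b' : ℝ} (h : a ≤ a') (h' : a + b ≤ a' + b') (q : ℝ × ℝ) :
    symbolWeight a b q ≤ symbolWeight a' b' q := by
  have h₁ := one_le_japanese q.1
  have h₂ := japanese_le q
  suffices H : symbolWeight (a - a') (b - b') q ≤ 1 by
    calc symbolWeight a b q = symbolWeight (a - a') (b - b') q * symbolWeight a' b' q := by
          rw [symbolWeight_mul]; simp
      _ ≤ 1 * symbolWeight a' b' q := by gcongr; exact (symbolWeight_pos _ _ _).le
      _ = _ := one_mul _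
  have hL : 1 ≤ √(1 + q.1 ^ 2 + q.2 ^ 2) := h₁.trans h₂
  rcases le_total b b' with hb | hb
  · exact mul_le_one₀ (Real.rpow_le_one_of_one_le_of_nonpos hL (by linarith))
      (Real.rpow_nonneg (by linarith) _)
      (Real.rpow_le_one_of_one_le_of_nonpos h₁ (by linarith))
  · calc symbolWeight (a - a') (b - b') q
        ≤ √(1 + q.1 ^ 2 + q.2 ^ 2) ^ (a - a') * √(1 + q.1 ^ 2 + q.2 ^ 2) ^ (b - b') := by
          unfold symbolWeight
          gcongr
      _ = √(1 + q.1 ^ 2 + q.2 ^ 2) ^ (a - a' + (b - b')) := by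
          rw [Real.rpow_add (by linarith)]
      _ ≤ 1 := Real.rpow_le_one_of_one_le_of_nonpos hL (by linarith)

namespace SymbolUpTo

variable {N : ℕ} {a b a' b' : ℝ} {f g : ℝ × ℝ → ℂ}

theorem bound (h : SymbolUpTo N a b f) : ∃ C, ∀ q, ‖f q‖ ≤ C * symbolWeight a b q := by
  cases N with
  | zero => exact h
  | succ N => exact h.1

theorem pred (h : SymbolUpTo (N + 1) a b f) : SymbolUpTo N a b f := by
  induction N generalizing a b f with
  | zero => exact h.1
  | succ N ih => exact ⟨h.1, ih h.2.1, ih h.2.2⟩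

theorem mono (h : SymbolUpTo N a b f) (ha : a ≤ a') (hab : a + b ≤ a' + b') :
    SymbolUpTo N a' b' f := by
  have key {a b a' b' : ℝ} {f : ℝ × ℝ → ℂ} (h : ∃ C, ∀ q, ‖f q‖ ≤ C * symbolWeight a b q)
      (ha : a ≤ a') (hab : a + b ≤ a' + b') : ∃ C, ∀ q, ‖f q‖ ≤ C * symbolWeight a' b' q := by
    obtain ⟨C, hC⟩ := h
    refine ⟨|C|, fun q => (hC q).trans ?_⟩
    have := symbolWeight_pos a b q
    gcongr
    exacts [le_abs_self C, symbolWeight_le ha hab q]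
  induction N generalizing a b a' b' f with
  | zero => exact key h ha hab
  | succ N ih =>
    exact ⟨key h.1 ha hab, ih h.2.1 ha (by linarith), ih h.2.2 (by linarith) (by linarith)⟩

theorem add (hf : ContDiff ℝ ∞ f) (hg : ContDiff ℝ ∞ g) (h : SymbolUpTo N a b f)
    (h' : SymbolUpTo N a b g) : SymbolUpTo N a b (fun q => f q + g q) := by
  have key {a b : ℝ} {f g : ℝ × ℝ → ℂ} (h : ∃ C, ∀ q, ‖f q‖ ≤ C * symbolWeight a b q)
      (h' : ∃ C, ∀ q, ‖g q‖ ≤ C * symbolWeight a b q) :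
      ∃ C, ∀ q, ‖f q + g q‖ ≤ C * symbolWeight a b q := by
    obtain ⟨C, hC⟩ := h
    obtain ⟨C', hC'⟩ := h'
    refine ⟨C + C', fun q => (norm_add_le _ _).trans ?_⟩
    rw [add_mul]
    exact add_le_add (hC q) (hC' q)
  induction N generalizing a b f g with
  | zero => exact key h h'
  | succ N ih =>
    refine ⟨key h.1 h'.1, ?_, ?_⟩
    · rw [dX_add hf hg]
      exact ih hf.dX hg.dX h.2.1 h'.2.1
    · rw [dY_add hf hg]
      exact ih hf.dY hg.dY h.2.2 h'.2.2

theorem mul (hf : ContDiff ℝ ∞ f) (hg : ContDiff ℝ ∞ g) (h : SymbolUpTo N a b f)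
    (h' : SymbolUpTo N a' b' g) : SymbolUpTo N (a + a') (b + b') (fun q => f q * g q) := by
  have key {a b a' b' : ℝ} {f g : ℝ × ℝ → ℂ} (h : ∃ C, ∀ q, ‖f q‖ ≤ C * symbolWeight a b q)
      (h' : ∃ C, ∀ q, ‖g q‖ ≤ C * symbolWeight a' b' q) :
      ∃ C, ∀ q, ‖f q * g q‖ ≤ C * symbolWeight (a + a') (b + b') q := by
    obtain ⟨C, hC⟩ := h
    obtain ⟨C', hC'⟩ := h'
    refine ⟨C * C', fun q => ?_⟩
    calc ‖f q * g q‖ = ‖f q‖ * ‖g q‖ := norm_mul _ _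
      _ ≤ (C * symbolWeight a b q) * (C' * symbolWeight a' b' q) :=
        mul_le_mul (hC q) (hC' q) (norm_nonneg _) ((norm_nonneg _).trans (hC q))
      _ = _ := by rw [← symbolWeight_mul]; ring
  induction N generalizing a b a' b' f g with
  | zero => exact key h h'
  | succ N ih =>
    refine ⟨key h.1 h'.1, ?_, ?_⟩
    · rw [dX_mul hf hg]
      exact add (hf.dX.mul hg) (hf.mul hg.dX)
        ((ih hf.dX hg h.2.1 h'.pred).mono (by linarith) (by linarith))
        ((ih hf hg.dX h.pred h'.2.1).mono (by linarith) (by linarith))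
    · rw [dY_mul hf hg]
      exact add (hf.dY.mul hg) (hf.mul hg.dY)
        ((ih hf.dY hg h.2.2 h'.pred).mono (by linarith) (by linarith))
        ((ih hf hg.dY h.pred h'.2.2).mono (by linarith) (by linarith))

theorem zero (N : ℕ) (a b : ℝ) : SymbolUpTo N a b (fun _ => 0) := by
  induction N generalizing a b with
  | zero => exact ⟨0, fun q => by simp⟩
  | succ N ih =>
    refine ⟨⟨0, fun q => by simp⟩, ?_, ?_⟩
    · rw [dX_const]; exact ih _ _
    · rw [dY_const]; exact ih _ _

theorem const (N : ℕ) (c : ℂ) : SymbolUpTo N 0 0 (fun _ => c) := by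
  have h : ∃ C, ∀ q, ‖c‖ ≤ C * symbolWeight 0 0 q := ⟨‖c‖, fun q => by simp [symbolWeight]⟩
  cases N with
  | zero => exact h
  | succ N =>
    refine ⟨h, ?_, ?_⟩
    · rw [dX_const]; exact zero _ _ _
    · rw [dY_const]; exact zero _ _ _

theorem const_mul (c : ℂ) (hf : ContDiff ℝ ∞ f) (h : SymbolUpTo N a b f) :
    SymbolUpTo N a b (fun q => c * f q) := by
  simpa using mul contDiff_const hf (const N c) h

theorem sub (hf : ContDiff ℝ ∞ f) (hg : ContDiff ℝ ∞ g) (h : SymbolUpTo N a b f)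
    (h' : SymbolUpTo N a b g) : SymbolUpTo N a b (fun q => f q - g q) := by
  simpa [sub_eq_add_neg] using add hf (contDiff_const.mul hg) h (const_mul (-1) hg h')

theorem fst (N : ℕ) : SymbolUpTo N 0 1 (fun q => (q.1 : ℂ)) := by
  have h : ∃ C, ∀ q : ℝ × ℝ, ‖(q.1 : ℂ)‖ ≤ C * symbolWeight 0 1 q := by
    refine ⟨1, fun q => ?_⟩
    simpa [symbolWeight] using Real.abs_le_sqrt (by linarith : q.1 ^ 2 ≤ 1 + q.1 ^ 2)
  cases N with
  | zero => exact h
  | succ N =>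
    refine ⟨h, ?_, ?_⟩
    · rw [dX_fst]
      exact (const N 1).mono (by norm_num) (by norm_num)
    · rw [dY_fst]
      exact zero _ _ _

theorem fst' (N : ℕ) : SymbolUpTo N 1 0 (fun q => (q.1 : ℂ)) :=
  (fst N).mono (by norm_num) (by norm_num)

theorem snd (N : ℕ) : SymbolUpTo N 1 0 (fun q => (q.2 : ℂ)) := by
  have h : ∃ C, ∀ q : ℝ × ℝ, ‖(q.2 : ℂ)‖ ≤ C * symbolWeight 1 0 q := by
    refine ⟨1, fun q => ?_⟩
    simpa [symbolWeight] using Real.abs_le_sqrt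
      (by nlinarith [sq_nonneg q.1] : q.2 ^ 2 ≤ 1 + q.1 ^ 2 + q.2 ^ 2)
  cases N with
  | zero => exact h
  | succ N =>
    refine ⟨h, ?_, ?_⟩
    · rw [dX_snd]
      exact zero _ _ _
    · rw [dY_snd]
      exact (const N 1).mono (by norm_num) (by norm_num)

theorem of_forall_iterate (h : ∀ k₁ k₂ : ℕ, ∃ C, ∀ q,
      ‖dY^[k₁] (dX^[k₂] f) q‖ ≤ C * symbolWeight (a - k₁) (b - k₂) q)
    (hf : ContDiff ℝ ∞ f) (N : ℕ) : SymbolUpTo N a b f := by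
  induction N generalizing a b f with
  | zero => simpa only [SymbolUpTo, Function.iterate_zero, id, Nat.cast_zero, sub_zero]
      using h 0 0
  | succ N ih =>
    refine ⟨by simpa using h 0 0, ih (fun k₁ k₂ => ?_) hf.dX, ih (fun k₁ k₂ => ?_) hf.dY⟩
    · have h := h k₁ (k₂ + 1)
      push_cast at h
      rwa [Function.iterate_succ_apply, add_comm (k₂ : ℝ), ← sub_sub] at h
    · have h := h (k₁ + 1) k₂
      push_cast at h
      rwa [Function.iterate_succ_apply, ← dX_iterate_dY hf, add_comm (k₁ : ℝ), ← sub_sub] at h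

theorem iterate (k₁ k₂ : ℕ) (h : ∀ N, SymbolUpTo N a b f) :
    ∃ C, ∀ q, ‖dY^[k₁] (dX^[k₂] f) q‖ ≤ C * symbolWeight (a - k₁) (b - k₂) q := by
  induction k₂ generalizing b f with
  | zero =>
    induction k₁ generalizing a f with
    | zero => simpa using (h 0).bound
    | succ k₁ ih =>
      have := ih (a := a - 1) (f := dY f) fun N => (h (N + 1)).2.2
      rwa [Nat.cast_succ, add_comm (k₁ : ℝ), ← sub_sub]
  | succ k₂ ih =>
    have := ih (b := b - 1) (f := dX f) fun N => (h (N + 1)).2.1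
    push_cast
    rwa [add_comm (k₂ : ℝ), ← sub_sub]

end SymbolUpTo

theorem contDiff_ofReal_fst : ContDiff ℝ ∞ fun q : ℝ × ℝ => (q.1 : ℂ) :=
  Complex.ofRealCLM.contDiff.comp contDiff_fst

theorem contDiff_ofReal_snd : ContDiff ℝ ∞ fun q : ℝ × ℝ => (q.2 : ℂ) :=
  Complex.ofRealCLM.contDiff.comp contDiff_snd

/-- The function `λ⁻²`. -/
def invSqWeight (q : ℝ × ℝ) : ℂ := ((1 + q.1 ^ 2 + q.2 ^ 2 : ℝ) : ℂ)⁻¹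

theorem one_add_sq_add_sq_ne_zero (q : ℝ × ℝ) : ((1 + q.1 ^ 2 + q.2 ^ 2 : ℝ) : ℂ) ≠ 0 := by
  exact_mod_cast (by positivity : (1 + q.1 ^ 2 + q.2 ^ 2 : ℝ) ≠ 0)

theorem contDiff_invSqWeight : ContDiff ℝ ∞ invSqWeight :=
  (Complex.ofRealCLM.contDiff.comp
    (by fun_prop : ContDiff ℝ ∞ fun q : ℝ × ℝ => 1 + q.1 ^ 2 + q.2 ^ 2)).inv
    one_add_sq_add_sq_ne_zero

theorem fderiv_invSqWeight (q v : ℝ × ℝ) :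
    fderiv ℝ invSqWeight q v
      = -2 * (q.1 * v.1 + q.2 * v.2) * (invSqWeight q * invSqWeight q) := by
  have h₁ := (((hasFDerivAt_fst (𝕜 := ℝ) (p := q)).pow 2).const_add 1).add
    ((hasFDerivAt_snd (𝕜 := ℝ) (p := q)).pow 2)
  have h₂ := Complex.ofRealCLM.hasFDerivAt.comp q h₁
  have h₃ := (hasFDerivAt_inv' (𝕜 := ℝ) (one_add_sq_add_sq_ne_zero q)).comp q h₂
  rw [show fderiv ℝ invSqWeight q = _ from h₃.fderiv]
  simp [invSqWeight]
  ring

theorem symbolUpTo_invSqWeight (N : ℕ) : SymbolUpTo N (-2) 0 invSqWeight := by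
  have h : ∃ C, ∀ q, ‖invSqWeight q‖ ≤ C * symbolWeight (-2) 0 q := by
    refine ⟨1, fun q => le_of_eq ?_⟩
    have h0 : 0 ≤ 1 + q.1 ^ 2 + q.2 ^ 2 := by positivity
    rw [invSqWeight, norm_inv, Complex.norm_real, Real.norm_of_nonneg h0, symbolWeight,
      Real.rpow_neg (Real.sqrt_nonneg _), Real.rpow_two, Real.sq_sqrt h0]
    simp
  have hj := contDiff_invSqWeight
  induction N with
  | zero => exact h
  | succ N ih =>
    have hX : dX invSqWeight = fun q => -2 * ((q.1 : ℂ) * (invSqWeight q * invSqWeight q)) := by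
      funext q
      rw [dX, fderiv_invSqWeight]
      simp [mul_assoc]
    have hY : dY invSqWeight = fun q => -2 * ((q.2 : ℂ) * (invSqWeight q * invSqWeight q)) := by
      funext q
      rw [dY, fderiv_invSqWeight]
      simp [mul_assoc]
    refine ⟨h, ?_, ?_⟩
    · rw [hX]
      exact (SymbolUpTo.const_mul _ (contDiff_ofReal_fst.mul (hj.mul hj))
        ((SymbolUpTo.fst' N).mul contDiff_ofReal_fst (hj.mul hj) (ih.mul hj hj ih))).mono
          (by norm_num) (by norm_num)
    · rw [hY]
      exact (SymbolUpTo.const_mul _ (contDiff_ofReal_snd.mul (hj.mul hj))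
        ((SymbolUpTo.snd N).mul contDiff_ofReal_snd (hj.mul hj) (ih.mul hj hj ih))).mono
          (by norm_num) (by norm_num)

/-- The rotation flow of the harmonic oscillator. -/
def rot (t : ℝ) (q : ℝ × ℝ) : ℝ × ℝ :=
  (q.1 * Real.cos t + q.2 * Real.sin t, q.2 * Real.cos t - q.1 * Real.sin t)

/-- The integral of `f` along the rotation flow, with weight `w`. -/
def rotAvg (w : ℝ → ℂ) (f : ℝ × ℝ → ℂ) (q : ℝ × ℝ) : ℂ :=
  ∫ t in (0:ℝ)..(2 * π), w t * f (rot t q)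

theorem contDiff_rot : ContDiff ℝ ∞ fun z : (ℝ × ℝ) × ℝ => rot z.2 z.1 := by
  have hc : ContDiff ℝ ∞ fun z : (ℝ × ℝ) × ℝ => Real.cos z.2 := Real.contDiff_cos.comp contDiff_snd
  have hs : ContDiff ℝ ∞ fun z : (ℝ × ℝ) × ℝ => Real.sin z.2 := Real.contDiff_sin.comp contDiff_snd
  unfold rot
  fun_prop

theorem rot_norm_sq (t : ℝ) (q : ℝ × ℝ) :
    1 + (rot t q).1 ^ 2 + (rot t q).2 ^ 2 = 1 + q.1 ^ 2 + q.2 ^ 2 := by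
  simp only [rot]
  linear_combination (q.1 ^ 2 + q.2 ^ 2) * Real.sin_sq_add_cos_sq t

theorem hasDerivAt_rot (t : ℝ) (q : ℝ × ℝ) :
    HasDerivAt (fun s => rot s q) ((rot t q).2, -(rot t q).1) t := by
  have h := (((Real.hasDerivAt_cos t).const_mul q.1).add
      ((Real.hasDerivAt_sin t).const_mul q.2)).prodMk
    (((Real.hasDerivAt_cos t).const_mul q.2).sub ((Real.hasDerivAt_sin t).const_mul q.1))
  exact h.congr_deriv (by simp only [rot]; ext <;> ring)

section RotAvg

variable {w : ℝ → ℂ} {f : ℝ × ℝ → ℂ}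

theorem contDiff_rotAvg_integrand (hw : ContDiff ℝ ∞ w) (hf : ContDiff ℝ ∞ f) :
    ContDiff ℝ ∞ fun z : (ℝ × ℝ) × ℝ => w z.2 * f (rot z.2 z.1) :=
  (hw.comp contDiff_snd).mul (hf.comp contDiff_rot)

theorem intervalIntegrable_rotAvg (hw : ContDiff ℝ ∞ w) (hf : ContDiff ℝ ∞ f) (q : ℝ × ℝ) :
    IntervalIntegrable (fun t => w t * f (rot t q)) volume 0 (2 * π) :=
  ((contDiff_rotAvg_integrand hw hf).continuous.comp
    (by fun_prop : Continuous fun t : ℝ => (q, t))).intervalIntegrable _ _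

theorem contDiff_rotAvg (hw : ContDiff ℝ ∞ w) (hf : ContDiff ℝ ∞ f) :
    ContDiff ℝ ∞ (rotAvg w f) :=
  contDiff_infty.2 fun n => contDiff_intervalIntegral.{0} _ _ n (contDiff_rotAvg_integrand hw hf)

theorem fderiv_rotAvg (hw : ContDiff ℝ ∞ w) (hf : ContDiff ℝ ∞ f) (q v : ℝ × ℝ) :
    fderiv ℝ (rotAvg w f) q v = ∫ t in (0:ℝ)..(2 * π),
      w t * (((rot t v).1 : ℂ) * dX f (rot t q) + ((rot t v).2 : ℂ) * dY f (rot t q)) := by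
  set L : ℝ → ℝ × ℝ →L[ℝ] ℝ × ℝ := fun t =>
    (Real.cos t • ContinuousLinearMap.fst ℝ ℝ ℝ + Real.sin t • ContinuousLinearMap.snd ℝ ℝ ℝ).prod
    (Real.cos t • ContinuousLinearMap.snd ℝ ℝ ℝ - Real.sin t • ContinuousLinearMap.fst ℝ ℝ ℝ)
  have hL (t : ℝ) (u : ℝ × ℝ) : L t u = rot t u := by
    simp [L, rot, mul_comm]
  have hLc : Continuous L := by
    have h (l : ℝ × ℝ →L[ℝ] ℝ) (l' : ℝ × ℝ →L[ℝ] ℝ) :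
        l.prod l' = (ContinuousLinearMap.inl ℝ ℝ ℝ).comp l +
          (ContinuousLinearMap.inr ℝ ℝ ℝ).comp l' := by
      ext <;> simp
    simp only [L, h]
    fun_prop
  set F' : ℝ × ℝ → ℝ → ℝ × ℝ →L[ℝ] ℂ := fun u t => w t • (fderiv ℝ f (rot t u)).comp (L t)
  have hF' : Continuous fun z : (ℝ × ℝ) × ℝ => F' z.1 z.2 := by
    have h₁ : Continuous fun z : (ℝ × ℝ) × ℝ => fderiv ℝ f (rot z.2 z.1) :=
      (hf.continuous_fderiv (by simp)).comp contDiff_rot.continuous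
    have h₂ : Continuous fun z : (ℝ × ℝ) × ℝ => w z.2 := hw.continuous.comp continuous_snd
    exact h₂.smul (h₁.clm_comp (hLc.comp continuous_snd))
  have h (u : ℝ × ℝ) (t : ℝ) : HasFDerivAt (fun y => w t * f (rot t y)) (F' u t) u := by
    have hr : HasFDerivAt (rot t) (L t) u := by
      rw [show rot t = L t from funext fun y => (hL t y).symm]
      exact (L t).hasFDerivAt
    exact (((hf.differentiable (by simp)) (rot t u)).hasFDerivAt.comp u hr).const_mul (w t)
  have hd := hasFDerivAt_intervalIntegral_of_continuous
    (contDiff_rotAvg_integrand hw hf).continuous hF' h 0 (2 * π) q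
  have hc : Continuous (F' q) := hF'.comp (by fun_prop : Continuous fun t : ℝ => (q, t))
  rw [show fderiv ℝ (rotAvg w f) q = _ from hd.fderiv,
    ContinuousLinearMap.intervalIntegral_apply (hc.intervalIntegrable _ _)]
  refine intervalIntegral.integral_congr fun t _ => ?_
  simp [F', hL, fderiv_apply_eq_dX_add_dY f]

theorem dX_rotAvg (hw : ContDiff ℝ ∞ w) (hf : ContDiff ℝ ∞ f) (q : ℝ × ℝ) :
    dX (rotAvg w f) q = rotAvg (fun t => w t * Real.cos t) (dX f) q
      - rotAvg (fun t => w t * Real.sin t) (dY f) q := by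
  have hc : ContDiff ℝ ∞ fun t => w t * (Real.cos t : ℂ) :=
    hw.mul (Complex.ofRealCLM.contDiff.comp Real.contDiff_cos)
  have hs : ContDiff ℝ ∞ fun t => w t * (Real.sin t : ℂ) :=
    hw.mul (Complex.ofRealCLM.contDiff.comp Real.contDiff_sin)
  rw [dX, fderiv_rotAvg hw hf, rotAvg, rotAvg, ← intervalIntegral.integral_sub
    (intervalIntegrable_rotAvg hc hf.dX q) (intervalIntegrable_rotAvg hs hf.dY q)]
  refine intervalIntegral.integral_congr fun t _ => ?_
  simp only [rot]
  push_cast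
  ring

theorem dY_rotAvg (hw : ContDiff ℝ ∞ w) (hf : ContDiff ℝ ∞ f) (q : ℝ × ℝ) :
    dY (rotAvg w f) q = rotAvg (fun t => w t * Real.sin t) (dX f) q
      + rotAvg (fun t => w t * Real.cos t) (dY f) q := by
  have hc : ContDiff ℝ ∞ fun t => w t * (Real.cos t : ℂ) :=
    hw.mul (Complex.ofRealCLM.contDiff.comp Real.contDiff_cos)
  have hs : ContDiff ℝ ∞ fun t => w t * (Real.sin t : ℂ) :=
    hw.mul (Complex.ofRealCLM.contDiff.comp Real.contDiff_sin)
  rw [dY, fderiv_rotAvg hw hf, rotAvg, rotAvg, ← intervalIntegral.integral_add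
    (intervalIntegrable_rotAvg hs hf.dX q) (intervalIntegrable_rotAvg hc hf.dY q)]
  refine intervalIntegral.integral_congr fun t _ => ?_
  simp only [rot]
  push_cast
  ring

/-- The Euler field commutes with averaging along the rotation flow. -/
theorem euler_rotAvg (hw : ContDiff ℝ ∞ w) (hf : ContDiff ℝ ∞ f) (q : ℝ × ℝ) :
    q.1 * dX (rotAvg w f) q + q.2 * dY (rotAvg w f) q
      = rotAvg w (fun q => q.1 * dX f q + q.2 * dY f q) q := by
  have h := fderiv_rotAvg hw hf q q
  rwa [fderiv_apply_eq_dX_add_dY, Complex.real_smul, Complex.real_smul] at h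

/-- The generator of the rotation flow applied to an average along this flow. -/
theorem rotation_rotAvg (hw : ContDiff ℝ ∞ w) (hf : ContDiff ℝ ∞ f) (q : ℝ × ℝ) :
    q.2 * dX (rotAvg w f) q - q.1 * dY (rotAvg w f) q
      = (w (2 * π) - w 0) * f q - rotAvg (deriv w) f q := by
  have h := fderiv_rotAvg hw hf q (q.2, -q.1)
  have hcurve : Continuous fun t : ℝ => rot t q :=
    contDiff_rot.continuous.comp (by fun_prop : Continuous fun t : ℝ => (q, t))
  have hd (t : ℝ) : HasDerivAt (fun s => f (rot s q))
      (((rot t (q.2, -q.1)).1 : ℂ) * dX f (rot t q)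
        + ((rot t (q.2, -q.1)).2 : ℂ) * dY f (rot t q)) t := by
    refine (((hf.differentiable (by simp)) (rot t q)).hasFDerivAt.comp_hasDerivAt t
      (hasDerivAt_rot t q)).congr_deriv ?_
    rw [fderiv_apply_eq_dX_add_dY]
    simp only [rot, Complex.real_smul]
    push_cast
    ring
  have hcont : Continuous fun t : ℝ => ((rot t (q.2, -q.1)).1 : ℂ) * dX f (rot t q)
      + ((rot t (q.2, -q.1)).2 : ℂ) * dY f (rot t q) := by
    have h₁ := hf.dX.continuous.comp hcurve
    have h₂ := hf.dY.continuous.comp hcurve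
    simp only [Function.comp_def] at h₁ h₂
    have h₃ : Continuous fun t : ℝ => rot t (q.2, -q.1) :=
      contDiff_rot.continuous.comp (by fun_prop : Continuous fun t : ℝ => ((q.2, -q.1), t))
    fun_prop
  rw [intervalIntegral.integral_mul_deriv_eq_deriv_mul
    (fun t _ => ((hw.differentiable (by simp)) t).hasDerivAt) (fun t _ => hd t)
    ((hw.continuous_deriv (by simp)).intervalIntegrable _ _) (hcont.intervalIntegrable _ _),
    fderiv_apply_eq_dX_add_dY] at h
  have h₀ : rot 0 q = q := by simp [rot]
  have h₁ : rot (2 * π) q = q := by simp [rot]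
  rw [h₀, h₁] at h
  simp only [Complex.real_smul, Complex.ofReal_neg] at h
  rw [rotAvg]
  linear_combination h

theorem dX_rotAvg_eq (hw : ContDiff ℝ ∞ w) (hf : ContDiff ℝ ∞ f) :
    dX (rotAvg w f) = fun q => invSqWeight q *
      (q.1 * rotAvg w (fun q => q.1 * dX f q + q.2 * dY f q) q
        + q.2 * ((w (2 * π) - w 0) * f q - rotAvg (deriv w) f q)
        + (rotAvg (fun t => w t * Real.cos t) (dX f) q
          - rotAvg (fun t => w t * Real.sin t) (dY f) q)) := by
  funext q
  rw [← euler_rotAvg hw hf, ← rotation_rotAvg hw hf, ← dX_rotAvg hw hf, invSqWeight,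
    eq_inv_mul_iff_mul_eq₀ (one_add_sq_add_sq_ne_zero q)]
  push_cast
  ring

theorem dY_rotAvg_eq (hw : ContDiff ℝ ∞ w) (hf : ContDiff ℝ ∞ f) :
    dY (rotAvg w f) = fun q => invSqWeight q *
      (q.2 * rotAvg w (fun q => q.1 * dX f q + q.2 * dY f q) q
        - q.1 * ((w (2 * π) - w 0) * f q - rotAvg (deriv w) f q)
        + (rotAvg (fun t => w t * Real.sin t) (dX f) q
          + rotAvg (fun t => w t * Real.cos t) (dY f) q)) := by
  funext q
  rw [← euler_rotAvg hw hf, ← rotation_rotAvg hw hf, ← dY_rotAvg hw hf, invSqWeight,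
    eq_inv_mul_iff_mul_eq₀ (one_add_sq_add_sq_ne_zero q)]
  push_cast
  ring

theorem rotAvg_bound {M : ℝ} (hw : ContDiff ℝ ∞ w)
    (h : ∃ C, ∀ q, ‖f q‖ ≤ C * symbolWeight M 0 q) :
    ∃ C, ∀ q, ‖rotAvg w f q‖ ≤ C * symbolWeight M 0 q := by
  obtain ⟨C, hC⟩ := h
  obtain ⟨B, hB⟩ := (isCompact_uIcc (a := 0) (b := 2 * π)).exists_bound_of_continuousOn
    hw.continuous.continuousOn
  refine ⟨B * C * |2 * π - 0|, fun q => ?_⟩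
  have hbound : ∀ t ∈ Set.uIoc 0 (2 * π), ‖w t * f (rot t q)‖ ≤ B * (C * symbolWeight M 0 q) := by
    intro t ht
    have hrot : symbolWeight M 0 (rot t q) = symbolWeight M 0 q := by
      simp [symbolWeight, rot_norm_sq]
    have hBt := hB t (Set.uIoc_subset_uIcc ht)
    rw [norm_mul, ← hrot]
    exact mul_le_mul hBt (hC _) (norm_nonneg _) ((norm_nonneg _).trans hBt)
  exact (intervalIntegral.norm_integral_le_of_norm_le_const hbound).trans_eq (by ring)

/-- If averages along the rotation flow satisfy the symbol estimates up to order `N`, then so do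
their first derivatives, with one power of `λ` gained. -/
theorem symbolUpTo_deriv_rotAvg {M : ℝ} {N : ℕ}
    (ih : ∀ {w : ℝ → ℂ} {f : ℝ × ℝ → ℂ}, ContDiff ℝ ∞ w → ContDiff ℝ ∞ f →
      (∀ N, SymbolUpTo N M 0 f) → SymbolUpTo N M 0 (rotAvg w f))
    (hw : ContDiff ℝ ∞ w) (hf : ContDiff ℝ ∞ f) (h : ∀ N, SymbolUpTo N M 0 f) :
    SymbolUpTo N (M - 1) 0 (dX (rotAvg w f)) ∧ SymbolUpTo N (M - 1) 0 (dY (rotAvg w f)) := by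
  have hc : ContDiff ℝ ∞ fun t => w t * (Real.cos t : ℂ) :=
    hw.mul (Complex.ofRealCLM.contDiff.comp Real.contDiff_cos)
  have hs : ContDiff ℝ ∞ fun t => w t * (Real.sin t : ℂ) :=
    hw.mul (Complex.ofRealCLM.contDiff.comp Real.contDiff_sin)
  have hx := contDiff_ofReal_fst
  have hy := contDiff_ofReal_snd
  have hEf : ContDiff ℝ ∞ fun q : ℝ × ℝ => (q.1 : ℂ) * dX f q + q.2 * dY f q :=
    (hx.mul hf.dX).add (hy.mul hf.dY)
  have sX (N : ℕ) : SymbolUpTo N M 0 (dX f) := (h (N + 1)).2.1.mono (by simp) (by simp)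
  have sY (N : ℕ) : SymbolUpTo N M 0 (dY f) := (h (N + 1)).2.2.mono (by simp) (by simp)
  have sE (N : ℕ) : SymbolUpTo N M 0 fun q : ℝ × ℝ => (q.1 : ℂ) * dX f q + q.2 * dY f q := by
    refine SymbolUpTo.add (hx.mul hf.dX) (hy.mul hf.dY) ?_ ?_
    · exact ((SymbolUpTo.fst N).mul hx hf.dX (h (N + 1)).2.1).mono (by simp) (by simp)
    · exact ((SymbolUpTo.snd N).mul hy hf.dY (h (N + 1)).2.2).mono (by simp) (by simp)
  have hdw : ContDiff ℝ ∞ (deriv w) := (contDiff_infty_iff_deriv.1 hw).2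
  have cE := contDiff_rotAvg hw hEf
  have cd := contDiff_rotAvg hdw hf
  have cV := (contDiff_const (c := w (2 * π) - w 0)).mul hf |>.sub cd
  have sV : SymbolUpTo N M 0 fun q => (w (2 * π) - w 0) * f q - rotAvg (deriv w) f q :=
    SymbolUpTo.sub (contDiff_const.mul hf) cd (SymbolUpTo.const_mul _ hf (h N)) (ih hdw hf h)
  have sIE : SymbolUpTo N M 0 (rotAvg w _) := ih hw hEf sE
  have lift {g : ℝ × ℝ → ℂ} (hg : SymbolUpTo N M 0 g) : SymbolUpTo N (1 + M) (0 + 0) g :=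
    hg.mono (by linarith) (by linarith)
  rw [dX_rotAvg_eq hw hf, dY_rotAvg_eq hw hf]
  have cXc := contDiff_rotAvg hc hf.dX
  have cXs := contDiff_rotAvg hs hf.dX
  have cYc := contDiff_rotAvg hc hf.dY
  have cYs := contDiff_rotAvg hs hf.dY
  constructor
  · have c := ((hx.mul cE).add (hy.mul cV)).add (cXc.sub cYs)
    have s := SymbolUpTo.add ((hx.mul cE).add (hy.mul cV)) (cXc.sub cYs)
      (SymbolUpTo.add (hx.mul cE) (hy.mul cV) ((SymbolUpTo.fst' N).mul hx cE sIE)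
        ((SymbolUpTo.snd N).mul hy cV sV))
      (lift (SymbolUpTo.sub cXc cYs (ih hc hf.dX sX) (ih hs hf.dY sY)))
    exact ((symbolUpTo_invSqWeight N).mul contDiff_invSqWeight c s).mono
      (by linarith) (by linarith)
  · have c := ((hy.mul cE).sub (hx.mul cV)).add (cXs.add cYc)
    have s := SymbolUpTo.add ((hy.mul cE).sub (hx.mul cV)) (cXs.add cYc)
      (SymbolUpTo.sub (hy.mul cE) (hx.mul cV) ((SymbolUpTo.snd N).mul hy cE sIE)
        ((SymbolUpTo.fst' N).mul hx cV sV))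
      (lift (SymbolUpTo.add cXs cYc (ih hs hf.dX sX) (ih hc hf.dY sY)))
    exact ((symbolUpTo_invSqWeight N).mul contDiff_invSqWeight c s).mono
      (by linarith) (by linarith)

/-- Averaging along the rotation flow preserves symbol estimates in powers of `λ`. -/
theorem symbolUpTo_rotAvg {M : ℝ} (N : ℕ) (hw : ContDiff ℝ ∞ w) (hf : ContDiff ℝ ∞ f)
    (h : ∀ N, SymbolUpTo N M 0 f) : SymbolUpTo N M 0 (rotAvg w f) := by
  induction N generalizing w f with
  | zero => exact rotAvg_bound hw (h 0)
  | succ N ih =>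
    obtain ⟨hX, hY⟩ := symbolUpTo_deriv_rotAvg ih hw hf h
    exact ⟨rotAvg_bound hw (h 0), hX.mono (by linarith) (by linarith), hY⟩

end RotAvg

theorem SymbolUpTo.ofReal {p : ℝ × ℝ → ℝ} {a b : ℝ} (hp : ContDiff ℝ ∞ p)
    (h : ∀ k₁ k₂ : ℕ, ∃ C, ∀ q, |dY^[k₁] (dX^[k₂] p) q| ≤ C * symbolWeight (a - k₁) (b - k₂) q)
    (N : ℕ) : SymbolUpTo N a b (fun q => (p q : ℂ)) := by
  have hX (k : ℕ) : dX^[k] (fun q => (p q : ℂ)) = fun q => ((dX^[k] p q : ℝ) : ℂ) := by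
    induction k with
    | zero => rfl
    | succ k ih =>
      rw [Function.iterate_succ_apply', ih, dX_ofReal (hp.dX_iterate k),
        Function.iterate_succ_apply']
  have hY {g : ℝ × ℝ → ℝ} (hg : ContDiff ℝ ∞ g) (k : ℕ) :
      dY^[k] (fun q => (g q : ℂ)) = fun q => ((dY^[k] g q : ℝ) : ℂ) := by
    induction k with
    | zero => rfl
    | succ k ih =>
      rw [Function.iterate_succ_apply', ih, dY_ofReal (hg.dY_iterate k),
        Function.iterate_succ_apply']
  refine of_forall_iterate (f := fun q => (p q : ℂ)) (fun k₁ k₂ => ?_)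
    (Complex.ofRealCLM.contDiff.comp hp) N
  rw [hX, hY (hp.dX_iterate k₂)]
  simpa only [Complex.norm_real, Real.norm_eq_abs] using h k₁ k₂

/-- harmonic oscillator, `l = 1`: if `p ∈ S^{m₁,m₂}`, then
`I ∈ S^{m₁+[m₂],0}` and `∂_x I ∈ S^{m₁+[m₂]-1,0}`. -/
theorem stmt9 (m₁ m₂ α : ℝ) (p : ℝ → ℝ → ℝ)
    (hsm : ContDiff ℝ (⊤ : ℕ∞) fun q : ℝ × ℝ => p q.1 q.2)
    (hpb : ∀ k₁ k₂ : ℕ, ∃ C : ℝ, ∀ x ξ : ℝ,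
      |iteratedDeriv k₁ (fun ξ' => iteratedDeriv k₂ (fun x' => p x' ξ') x) ξ|
        ≤ C * Real.sqrt (1 + x ^ 2 + ξ ^ 2) ^ (m₁ - (k₁ : ℝ))
            * Real.sqrt (1 + x ^ 2) ^ (m₂ - (k₂ : ℝ))) :
    (∀ k₁ k₂ : ℕ, ∃ C : ℝ, ∀ x ξ : ℝ,
      ‖iteratedDeriv k₁ (fun ξ' => iteratedDeriv k₂ (fun x' => Iosc α p x' ξ') x) ξ‖
        ≤ C * Real.sqrt (1 + x ^ 2 + ξ ^ 2) ^ (m₁ + max m₂ 0 - (k₁ : ℝ))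
            * Real.sqrt (1 + x ^ 2) ^ (-(k₂ : ℝ))) ∧
    (∀ k₁ k₂ : ℕ, ∃ C : ℝ, ∀ x ξ : ℝ,
      ‖iteratedDeriv k₁ (fun ξ' => iteratedDeriv k₂
          (fun x' => deriv (fun x'' => Iosc α p x'' ξ') x') x) ξ‖
        ≤ C * Real.sqrt (1 + x ^ 2 + ξ ^ 2) ^ (m₁ + max m₂ 0 - 1 - (k₁ : ℝ))
            * Real.sqrt (1 + x ^ 2) ^ (-(k₂ : ℝ))) := by
  have hIosc (x ξ : ℝ) : Iosc α p x ξ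
      = rotAvg (fun t => Complex.exp (α * t * Complex.I)) (fun q => (p q.1 q.2 : ℂ)) (x, ξ) := rfl
  have hw : ContDiff ℝ ∞ fun t : ℝ => Complex.exp (α * t * Complex.I) :=
    ((contDiff_const.mul Complex.ofRealCLM.contDiff).mul contDiff_const).cexp
  have hf : ContDiff ℝ ∞ fun q : ℝ × ℝ => (p q.1 q.2 : ℂ) := Complex.ofRealCLM.contDiff.comp hsm
  have hp (N : ℕ) : SymbolUpTo N (m₁ + max m₂ 0) 0 fun q : ℝ × ℝ => (p q.1 q.2 : ℂ) := by
    refine (SymbolUpTo.ofReal (a := m₁) (b := m₂) hsm (fun k₁ k₂ => ?_) N).mono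
      (by simp) (by simp)
    obtain ⟨C, hC⟩ := hpb k₁ k₂
    refine ⟨C, fun q => ?_⟩
    rw [← iteratedDeriv_iteratedDeriv_eq hsm, symbolWeight, ← mul_assoc]
    exact hC q.1 q.2
  have hI := contDiff_rotAvg hw hf
  constructor
  · intro k₁ k₂
    obtain ⟨C, hC⟩ := SymbolUpTo.iterate k₁ k₂ fun N => symbolUpTo_rotAvg N hw hf hp
    refine ⟨C, fun x ξ => ?_⟩
    simp only [hIosc]
    rw [iteratedDeriv_iteratedDeriv_eq hI, mul_assoc, ← zero_sub]
    exact hC (x, ξ)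
  · intro k₁ k₂
    obtain ⟨C, hC⟩ := SymbolUpTo.iterate k₁ k₂ fun N =>
      (symbolUpTo_deriv_rotAvg (N := N) (symbolUpTo_rotAvg N) hw hf hp).1
    refine ⟨C, fun x ξ => ?_⟩
    simp only [hIosc, ← dX_eq_deriv hI]
    rw [iteratedDeriv_iteratedDeriv_eq hI.dX, mul_assoc, ← zero_sub]
    exact hC (x, ξ)
end
end
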